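/- arXiv:1211.5657 — 2 statements merged into one kernel-verified Lean document; each statement's English description precedes it below -/
import Mathlib

section
/- Let β > 0 and let Ψ=(ψ₊,ψ₋) be a C² entire solution of the two-component Ginzburg–Landau system that has degree pair [1,1] at infinity with standard asymptotics. Assume there exists x₀ ∈ ℝ² with ψ₊(x₀) = 0 and ψ₋(x₀) = 0, and assume there is a function f:[0,∞)→ℝ with f(0)=0, f(r)>0 for r>0, |f(r)−1| ≤ C/r² and |f'(r)| ≤ C/r³ for large r (for some C>0), such that u(x) := f(|x|)·exp(i·θ(x)) is a C² solution of −Δu = (1−|u|²)u on ℝ². Then there exist real constants φ₊, φ₋ such that ψ₊(x) = (1/√2)·u(x−x₀)·e^{iφ₊} and ψ₋(x) = (1/√2)·u(x−x₀)·e^{iφ₋} for all x ∈ ℝ². -/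
open MeasureTheory Metric Set Filter Complex

noncomputable section

/-- Sum of squared norms of the two first-order partial derivatives (plane identified with `ℂ`). -/
def gradSq (f : ℂ → ℂ) (x : ℂ) : ℝ :=
  ‖fderiv ℝ f x 1‖ ^ 2 + ‖fderiv ℝ f x Complex.I‖ ^ 2

/-- The Laplacian of `f : ℂ → ℂ` (plane identified with `ℂ`). -/
def lap (f : ℂ → ℂ) (x : ℂ) : ℂ :=
  fderiv ℝ (fun y => fderiv ℝ f y 1) x 1 + fderiv ℝ (fun y => fderiv ℝ f y Complex.I) x Complex.I

/-- `Ψ = (ψ₊,ψ₋)` is a `C²` entire solution of the two-component Ginzburg–Landau system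
with the integrability condition. -/
def EntireSolution (β : ℝ) (ψp ψm : ℂ → ℂ) : Prop :=
  ContDiff ℝ 2 ψp ∧ ContDiff ℝ 2 ψm ∧
  (∀ x : ℂ, -lap ψp x =
      ((1 - (‖ψp x‖ ^ 2 + ‖ψm x‖ ^ 2) : ℝ) : ℂ) * ψp x
        + (β : ℂ) * ((‖ψm x‖ ^ 2 - ‖ψp x‖ ^ 2 : ℝ) : ℂ) * ψp x) ∧
  (∀ x : ℂ, -lap ψm x =
      ((1 - (‖ψp x‖ ^ 2 + ‖ψm x‖ ^ 2) : ℝ) : ℂ) * ψm x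
        - (β : ℂ) * ((‖ψm x‖ ^ 2 - ‖ψp x‖ ^ 2 : ℝ) : ℂ) * ψm x) ∧
  Integrable (fun x : ℂ =>
    ((‖ψp x‖ ^ 2 + ‖ψm x‖ ^ 2 - 1) ^ 2 + β * (‖ψp x‖ ^ 2 - ‖ψm x‖ ^ 2) ^ 2))

/-- Ginzburg–Landau energy density with `ε = 1`. -/
def eDen1 (β : ℝ) (ψp ψm : ℂ → ℂ) (x : ℂ) : ℝ :=
  (1 / 2) * (gradSq ψp x + gradSq ψm x)
    + (1 / 4) * ((‖ψp x‖ ^ 2 + ‖ψm x‖ ^ 2 - 1) ^ 2)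
    + (β / 4) * ((‖ψp x‖ ^ 2 - ‖ψm x‖ ^ 2) ^ 2)

/-- Energy of `Ψ` on a set `Ω`. -/
def Eloc (β : ℝ) (ψp ψm : ℂ → ℂ) (Ω : Set ℂ) : ℝ := ∫ x in Ω, eDen1 β ψp ψm x

/-- `Ψ` has degree pair `[np, nm]` at infinity with the standard asymptotics. -/
def HasDegreeAtInfty (np nm : ℤ) (ψp ψm : ℂ → ℂ) : Prop :=
  ∃ R₀ > (0 : ℝ), ∃ c > (0 : ℝ), ∃ φp φm : ℝ, ∃ ρp ρm χp χm : ℂ → ℝ,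
    ContDiffOn ℝ 1 ρp {x : ℂ | R₀ ≤ ‖x‖} ∧ ContDiffOn ℝ 1 ρm {x : ℂ | R₀ ≤ ‖x‖} ∧
    ContDiffOn ℝ 1 χp {x : ℂ | R₀ ≤ ‖x‖} ∧ ContDiffOn ℝ 1 χm {x : ℂ | R₀ ≤ ‖x‖} ∧
    (∀ x : ℂ, R₀ ≤ ‖x‖ → 0 < ρp x ∧ 0 < ρm x) ∧
    (∀ x : ℂ, R₀ ≤ ‖x‖ →
      ψp x = (ρp x : ℂ) *
          Complex.exp (Complex.I * (((np : ℝ) * Complex.arg x + χp x : ℝ) : ℂ)) ∧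
      ψm x = (ρm x : ℂ) *
          Complex.exp (Complex.I * (((nm : ℝ) * Complex.arg x + χm x : ℝ) : ℂ))) ∧
    (∀ x : ℂ, R₀ ≤ ‖x‖ →
      |ρp x - 1 / Real.sqrt 2| ≤ c / ‖x‖ ^ 2 ∧ |ρm x - 1 / Real.sqrt 2| ≤ c / ‖x‖ ^ 2) ∧
    (∀ x : ℂ, R₀ ≤ ‖x‖ →
      ‖fderiv ℝ ρp x‖ ≤ c / ‖x‖ ^ 3 ∧ ‖fderiv ℝ ρm x‖ ≤ c / ‖x‖ ^ 3) ∧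
    IntegrableOn (fun x : ℂ =>
        ‖fderiv ℝ ρp x‖ ^ 2 + ‖fderiv ℝ ρm x‖ ^ 2
          + ‖fderiv ℝ χp x‖ ^ 2 + ‖fderiv ℝ χm x‖ ^ 2)
      {x : ℂ | R₀ ≤ ‖x‖} ∧
    (∀ δ > (0 : ℝ), ∃ M : ℝ, ∀ x : ℂ, M ≤ ‖x‖ → |χp x - φp| < δ ∧ |χm x - φm| < δ)

/-- `Ψ` is a locally minimizing solution (in the sense of De Giorgi). -/
def LocallyMinimizing (β : ℝ) (ψp ψm : ℂ → ℂ) : Prop :=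
  ∀ R > (0 : ℝ), ∀ Φp Φm : ℂ → ℂ,
    ContinuousOn Φp (closedBall 0 R) → ContinuousOn Φm (closedBall 0 R) →
    ContDiffOn ℝ 1 Φp (ball 0 R) → ContDiffOn ℝ 1 Φm (ball 0 R) →
    (∀ x : ℂ, ‖x‖ = R → Φp x = ψp x ∧ Φm x = ψm x) →
    Eloc β ψp ψm (ball 0 R) ≤ Eloc β Φp Φm (ball 0 R)

section

open scoped InnerProductSpace Topology Real

/-- The point with logarithmic polar coordinates `(t, θ)` about the origin. -/
def logPolar (t θ : ℝ) : ℂ := Complex.exp (t + θ * Complex.I)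

lemma contDiff_logPolar : ContDiff ℝ 2 (fun p : ℝ × ℝ => logPolar p.1 p.2) := by
  unfold logPolar
  have h1 : ContDiff ℝ 2 (fun p : ℝ × ℝ => (p.1 : ℂ)) := Complex.ofRealCLM.contDiff.comp contDiff_fst
  have h2 : ContDiff ℝ 2 (fun p : ℝ × ℝ => (p.2 : ℂ)) := Complex.ofRealCLM.contDiff.comp contDiff_snd
  exact (h1.add (h2.mul contDiff_const)).cexp

lemma continuous_logPolar : Continuous (fun p : ℝ × ℝ => logPolar p.1 p.2) :=
  contDiff_logPolar.continuous

lemma norm_logPolar (t θ : ℝ) : ‖logPolar t θ‖ = Real.exp t := by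
  simp [logPolar, Complex.norm_exp]

lemma logPolar_pi (t : ℝ) : logPolar t π = logPolar t (-π) := by
  simp only [logPolar, Complex.exp_add]
  push_cast
  rw [neg_mul, Complex.exp_neg, Complex.exp_pi_mul_I]; norm_num

lemma logPolar_eq (t θ : ℝ) : logPolar t θ = (Real.exp t : ℂ) * logPolar 0 θ := by
  simp [logPolar, Complex.exp_add]

lemma hasDerivAt_logPolar_fst (t θ : ℝ) :
    HasDerivAt (fun s => logPolar s θ) (logPolar t θ) t := by
  unfold logPolar
  have h : HasDerivAt (fun s : ℝ => (s : ℂ) + θ * Complex.I) 1 t :=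
    (HasDerivAt.ofReal_comp (hasDerivAt_id t)).add_const _
  simpa using h.cexp

lemma hasDerivAt_logPolar_snd (t θ : ℝ) :
    HasDerivAt (fun s => logPolar t s) (Complex.I * logPolar t θ) θ := by
  unfold logPolar
  have h : HasDerivAt (fun s : ℝ => (t : ℂ) + s * Complex.I) (1 * Complex.I) θ := by
    simpa using ((HasDerivAt.ofReal_comp (hasDerivAt_id θ)).mul_const Complex.I).const_add (t : ℂ)
  simpa [mul_comm] using h.cexp

/-- `h` is twice continuously differentiable with the listed first and second partials. -/
structure TwoJet (h ht hθ htt htθ hθθ : ℝ → ℝ → ℂ) : Prop where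
  contDiff : ContDiff ℝ 1 (fun p : ℝ × ℝ => h p.1 p.2)
  contDiff_t : ContDiff ℝ 1 (fun p : ℝ × ℝ => ht p.1 p.2)
  contDiff_θ : ContDiff ℝ 1 (fun p : ℝ × ℝ => hθ p.1 p.2)
  deriv_t : ∀ t θ, HasDerivAt (fun s => h s θ) (ht t θ) t
  deriv_θ : ∀ t θ, HasDerivAt (fun s => h t s) (hθ t θ) θ
  deriv_tt : ∀ t θ, HasDerivAt (fun s => ht s θ) (htt t θ) t
  deriv_tθ : ∀ t θ, HasDerivAt (fun s => ht t s) (htθ t θ) θ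
  deriv_θt : ∀ t θ, HasDerivAt (fun s => hθ s θ) (htθ t θ) t
  deriv_θθ : ∀ t θ, HasDerivAt (fun s => hθ t s) (hθθ t θ) θ

lemma hasDerivAt_fderiv_comp {ψ : ℂ → ℂ} (hψ : ContDiff ℝ 2 ψ) {γ δ : ℝ → ℂ} {γ' δ' : ℂ} {t : ℝ}
    (hγ : HasDerivAt γ γ' t) (hδ : HasDerivAt δ δ' t) :
    HasDerivAt (fun s => fderiv ℝ ψ (γ s) (δ s))
      (fderiv ℝ (fderiv ℝ ψ) (γ t) γ' (δ t) + fderiv ℝ ψ (γ t) δ') t := by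
  have h1 : Differentiable ℝ (fderiv ℝ ψ) :=
    (hψ.fderiv_right (m := 1) (by norm_num)).differentiable (by norm_num)
  have h2 : HasDerivAt (fun s => fderiv ℝ ψ (γ s)) (fderiv ℝ (fderiv ℝ ψ) (γ t) γ') t :=
    (h1 (γ t)).hasFDerivAt.comp_hasDerivAt t hγ
  exact h2.clm_apply hδ

lemma twoJet_logPolar {ψ : ℂ → ℂ} (hψ : ContDiff ℝ 2 ψ) (x₀ : ℂ) :
    TwoJet (fun t θ => ψ (x₀ + logPolar t θ))
      (fun t θ => fderiv ℝ ψ (x₀ + logPolar t θ) (logPolar t θ))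
      (fun t θ => fderiv ℝ ψ (x₀ + logPolar t θ) (Complex.I * logPolar t θ))
      (fun t θ => fderiv ℝ (fderiv ℝ ψ) (x₀ + logPolar t θ) (logPolar t θ) (logPolar t θ)
        + fderiv ℝ ψ (x₀ + logPolar t θ) (logPolar t θ))
      (fun t θ => fderiv ℝ (fderiv ℝ ψ) (x₀ + logPolar t θ) (logPolar t θ)
          (Complex.I * logPolar t θ)
        + fderiv ℝ ψ (x₀ + logPolar t θ) (Complex.I * logPolar t θ))
      (fun t θ => fderiv ℝ (fderiv ℝ ψ) (x₀ + logPolar t θ) (Complex.I * logPolar t θ)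
          (Complex.I * logPolar t θ)
        + fderiv ℝ ψ (x₀ + logPolar t θ) (Complex.I * (Complex.I * logPolar t θ))) := by
  have hd : Differentiable ℝ ψ := hψ.differentiable (by norm_num)
  have hE : ContDiff ℝ 1 (fun p : ℝ × ℝ => x₀ + logPolar p.1 p.2) :=
    contDiff_const.add (contDiff_logPolar.of_le (by norm_num))
  have hD : ContDiff ℝ 1 (fun p : ℝ × ℝ => fderiv ℝ ψ (x₀ + logPolar p.1 p.2)) :=
    (hψ.fderiv_right (m := 1) (by norm_num)).comp hE
  have hLt := fun t θ => (hasDerivAt_logPolar_fst t θ).const_add x₀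
  have hLθ := fun t θ => (hasDerivAt_logPolar_snd t θ).const_add x₀
  refine ⟨(hψ.of_le (by norm_num)).comp hE,
    hD.clm_apply (contDiff_logPolar.of_le (by norm_num)),
    hD.clm_apply (contDiff_const.mul (contDiff_logPolar.of_le (by norm_num))), ?_, ?_, ?_, ?_, ?_, ?_⟩
  · exact fun t θ => (hd _).hasFDerivAt.comp_hasDerivAt t (hLt t θ)
  · exact fun t θ => (hd _).hasFDerivAt.comp_hasDerivAt θ (hLθ t θ)
  · exact fun t θ => hasDerivAt_fderiv_comp hψ (hLt t θ) (hasDerivAt_logPolar_fst t θ)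
  · intro t θ
    have h := hasDerivAt_fderiv_comp hψ (hLθ t θ) (hasDerivAt_logPolar_snd t θ)
    have hs : IsSymmSndFDerivAt ℝ ψ (x₀ + logPolar t θ) :=
      (hψ.contDiffAt).isSymmSndFDerivAt (by simp)
    rwa [hs.eq] at h
  · exact fun t θ => hasDerivAt_fderiv_comp hψ (hLt t θ)
      ((hasDerivAt_logPolar_fst t θ).const_mul Complex.I)
  · exact fun t θ => hasDerivAt_fderiv_comp hψ (hLθ t θ)
      ((hasDerivAt_logPolar_snd t θ).const_mul Complex.I)

lemma lap_eq_snd_fderiv {ψ : ℂ → ℂ} (hψ : ContDiff ℝ 2 ψ) (x : ℂ) :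
    lap ψ x = fderiv ℝ (fderiv ℝ ψ) x 1 1
      + fderiv ℝ (fderiv ℝ ψ) x Complex.I Complex.I := by
  have h1 : DifferentiableAt ℝ (fderiv ℝ ψ) x :=
    (hψ.fderiv_right (m := 1) (by norm_num)).differentiable (by norm_num) x
  have key : ∀ v : ℂ, fderiv ℝ (fun y => fderiv ℝ ψ y v) x = (fderiv ℝ (fderiv ℝ ψ) x).flip v := by
    intro v
    rw [fderiv_clm_apply h1 (differentiableAt_const v)]
    simp
  simp [lap, key]

/-- A bilinear form evaluated on `z` and `I * z` has trace `‖z‖ ^ 2` times its trace. -/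
lemma bilin_trace (B : ℂ →L[ℝ] ℂ →L[ℝ] ℂ) (z : ℂ) :
    B z z + B (Complex.I * z) (Complex.I * z)
      = ((‖z‖ ^ 2 : ℝ) : ℂ) * (B 1 1 + B Complex.I Complex.I) := by
  obtain ⟨a, b⟩ := z
  have e1 : (⟨a, b⟩ : ℂ) = a • (1 : ℂ) + b • Complex.I := by
    apply Complex.ext <;> simp
  have e2 : Complex.I * (⟨a, b⟩ : ℂ) = (-b) • (1 : ℂ) + a • Complex.I := by
    apply Complex.ext <;> simp
  rw [e2, ← Complex.normSq_eq_norm_sq, Complex.normSq_mk, e1]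
  simp only [map_add, map_smul, _root_.add_apply, _root_.smul_apply]
  simp only [Complex.real_smul]
  push_cast
  ring

/-- The Laplacian is conformally covariant under the exponential map. -/
lemma logPolar_laplacian {ψ : ℂ → ℂ} (hψ : ContDiff ℝ 2 ψ) (x₀ : ℂ) (t θ : ℝ) :
    (fderiv ℝ (fderiv ℝ ψ) (x₀ + logPolar t θ) (logPolar t θ) (logPolar t θ)
        + fderiv ℝ ψ (x₀ + logPolar t θ) (logPolar t θ))
      + (fderiv ℝ (fderiv ℝ ψ) (x₀ + logPolar t θ) (Complex.I * logPolar t θ)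
          (Complex.I * logPolar t θ)
        + fderiv ℝ ψ (x₀ + logPolar t θ) (Complex.I * (Complex.I * logPolar t θ)))
      = ((Real.exp (2 * t) : ℝ) : ℂ) * lap ψ (x₀ + logPolar t θ) := by
  rw [lap_eq_snd_fderiv hψ]
  have h := bilin_trace (fderiv ℝ (fderiv ℝ ψ) (x₀ + logPolar t θ)) (logPolar t θ)
  rw [norm_logPolar, ← Real.exp_nat_mul] at h
  have e : Complex.I * (Complex.I * logPolar t θ) = - logPolar t θ := by
    rw [← mul_assoc, Complex.I_mul_I]; ring
  rw [e, map_neg]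
  push_cast at h ⊢
  rw [← h]
  ring

/-- Second-order jet of a product with a real function of the first variable. -/
lemma TwoJet.smul_fst {h ht hθ htt htθ hθθ : ℝ → ℝ → ℂ} (H : TwoJet h ht hθ htt htθ hθθ)
    {c c' c'' : ℝ → ℝ} (hc : ∀ t, HasDerivAt c (c' t) t) (hc' : ∀ t, HasDerivAt c' (c'' t) t)
    (hcC : ContDiff ℝ 1 c) (hcC' : ContDiff ℝ 1 c') :
    TwoJet (fun t θ => (c t : ℂ) * h t θ)
      (fun t θ => (c t : ℂ) * ht t θ + (c' t : ℂ) * h t θ)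
      (fun t θ => (c t : ℂ) * hθ t θ)
      (fun t θ => (c t : ℂ) * htt t θ + 2 * (c' t : ℂ) * ht t θ + (c'' t : ℂ) * h t θ)
      (fun t θ => (c t : ℂ) * htθ t θ + (c' t : ℂ) * hθ t θ)
      (fun t θ => (c t : ℂ) * hθθ t θ) := by
  have C0 : ContDiff ℝ 1 (fun p : ℝ × ℝ => (c p.1 : ℂ)) :=
    Complex.ofRealCLM.contDiff.comp (hcC.comp contDiff_fst)
  have C1 : ContDiff ℝ 1 (fun p : ℝ × ℝ => (c' p.1 : ℂ)) :=
    Complex.ofRealCLM.contDiff.comp (hcC'.comp contDiff_fst)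
  refine ⟨C0.mul H.contDiff, (C0.mul H.contDiff_t).add (C1.mul H.contDiff), C0.mul H.contDiff_θ,
    ?_, ?_, ?_, ?_, ?_, ?_⟩ <;> intro t θ
  · convert! (hc t).ofReal_comp.mul (H.deriv_t t θ) using 1; ring
  · exact (H.deriv_θ t θ).const_mul _
  · convert! ((hc t).ofReal_comp.mul (H.deriv_tt t θ)).add
      ((hc' t).ofReal_comp.mul (H.deriv_t t θ)) using 1
    ring
  · exact ((H.deriv_tθ t θ).const_mul _).add ((H.deriv_θ t θ).const_mul _)
  · convert! (hc t).ofReal_comp.mul (H.deriv_θt t θ) using 1; ring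
  · exact (H.deriv_θθ t θ).const_mul _

/-- The potential of the spinor system in terms of the rescaled components. -/
def spinorPot (β : ℝ) (a b : ℂ) : ℝ :=
  (1 / 2) * (1 - (‖a‖ ^ 2 + ‖b‖ ^ 2) / 2) ^ 2 + (β / 8) * (‖a‖ ^ 2 - ‖b‖ ^ 2) ^ 2

lemma spinorPot_nonneg {β : ℝ} (hβ : 0 < β) (a b : ℂ) : 0 ≤ spinorPot β a b := by
  unfold spinorPot; positivity

/-- Kinetic part of the Pohozaev density. -/
def pohKin (h ht hθ : ℝ → ℝ → ℂ) (t θ : ℝ) : ℝ :=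
  (1 / 2) * (-‖ht t θ‖ ^ 2 + ‖hθ t θ‖ ^ 2 - ‖h t θ‖ ^ 2)

lemma hasDerivAt_pohKin {h ht hθ htt htθ hθθ : ℝ → ℝ → ℂ} (H : TwoJet h ht hθ htt htθ hθθ)
    (t θ : ℝ) :
    HasDerivAt (fun s => pohKin h ht hθ s θ)
      (-⟪ht t θ, htt t θ⟫_ℝ + ⟪hθ t θ, htθ t θ⟫_ℝ - ⟪h t θ, ht t θ⟫_ℝ) t := by
  unfold pohKin
  convert! ((((H.deriv_tt t θ).norm_sq.neg).add (H.deriv_θt t θ).norm_sq).sub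
    (H.deriv_t t θ).norm_sq).const_mul (1 / 2 : ℝ) using 1
  ring

lemma contDiff_pohKin {h ht hθ htt htθ hθθ : ℝ → ℝ → ℂ} (H : TwoJet h ht hθ htt htθ hθθ) :
    ContDiff ℝ 1 (fun p : ℝ × ℝ => pohKin h ht hθ p.1 p.2) :=
  contDiff_const.mul ((((H.contDiff_t.norm_sq ℝ).neg).add (H.contDiff_θ.norm_sq ℝ)).sub
    (H.contDiff.norm_sq ℝ))

lemma hasDerivAt_pohFlux {h ht hθ htt htθ hθθ : ℝ → ℝ → ℂ} (H : TwoJet h ht hθ htt htθ hθθ)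
    (t θ : ℝ) :
    HasDerivAt (fun s => -⟪hθ t s, ht t s⟫_ℝ)
      (-(⟪hθ t θ, htθ t θ⟫_ℝ + ⟪hθθ t θ, ht t θ⟫_ℝ)) θ :=
  ((H.deriv_θθ t θ).inner ℝ (H.deriv_tθ t θ)).neg

lemma fderiv_apply_fst {a : ℝ × ℝ → ℝ} (ha : ContDiff ℝ 1 a) {t θ d : ℝ}
    (h : HasDerivAt (fun s => a (s, θ)) d t) : fderiv ℝ a (t, θ) (1, 0) = d := by
  have h1 : HasDerivAt (fun s : ℝ => (s, θ)) ((1 : ℝ), (0 : ℝ)) t :=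
    (hasDerivAt_id t).prodMk (hasDerivAt_const t θ)
  exact ((ha.differentiable (by norm_num) (t, θ)).hasFDerivAt.comp_hasDerivAt t h1).unique h

lemma fderiv_apply_snd {a : ℝ × ℝ → ℝ} (ha : ContDiff ℝ 1 a) {t θ d : ℝ}
    (h : HasDerivAt (fun s => a (t, s)) d θ) : fderiv ℝ a (t, θ) (0, 1) = d := by
  have h1 : HasDerivAt (fun s : ℝ => (t, s)) ((0 : ℝ), (1 : ℝ)) θ :=
    (hasDerivAt_const θ t).prodMk (hasDerivAt_id θ)
  exact ((ha.differentiable (by norm_num) (t, θ)).hasFDerivAt.comp_hasDerivAt θ h1).unique h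

/-- Divergence theorem on a cylinder: the flux in the periodic direction cancels. -/
lemma cylinder_divergence {a b : ℝ × ℝ → ℝ} (ha : ContDiff ℝ 1 a) (hb : ContDiff ℝ 1 b)
    (hper : ∀ t, b (t, π) = b (t, -π)) {Q : ℝ → ℝ → ℝ}
    (hQ : ∀ t θ, fderiv ℝ a (t, θ) (1, 0) + fderiv ℝ b (t, θ) (0, 1) = Q t θ) (t₁ t₂ : ℝ) :
    ∫ t in t₁..t₂, ∫ θ in (-π)..π, Q t θ
      = (∫ θ in (-π)..π, a (t₂, θ)) - ∫ θ in (-π)..π, a (t₁, θ) := by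
  have hc : Continuous (fun x : ℝ × ℝ => fderiv ℝ a x (1, 0) + fderiv ℝ b x (0, 1)) :=
    ((ha.continuous_fderiv (by norm_num)).clm_apply continuous_const).add
      ((hb.continuous_fderiv (by norm_num)).clm_apply continuous_const)
  have h := integral2_divergence_prod_of_hasFDerivAt_off_countable a b (fderiv ℝ a) (fderiv ℝ b)
    t₁ (-π) t₂ π ∅ countable_empty ha.continuous.continuousOn hb.continuous.continuousOn
    (fun x _ => (ha.differentiable (by norm_num) x).hasFDerivAt)
    (fun x _ => (hb.differentiable (by norm_num) x).hasFDerivAt)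
    (hc.continuousOn.integrableOn_compact (isCompact_uIcc.prod isCompact_uIcc))
  simp only [hQ, hper] at h
  rw [h]
  ring

/-- The Pohozaev density of the spinor system in logarithmic polar coordinates. -/
def pohDensity (β : ℝ) (m : ℝ → ℝ) (h ht hθ k kt kθ : ℝ → ℝ → ℂ) (t θ : ℝ) : ℝ :=
  pohKin h ht hθ t θ + pohKin k kt kθ t θ + m t * spinorPot β (h t θ) (k t θ)

lemma contDiff_pohDensity {β : ℝ} {m : ℝ → ℝ} (hm : ContDiff ℝ 1 m)
    {h ht hθ htt htθ hθθ k kt kθ ktt ktθ kθθ : ℝ → ℝ → ℂ}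
    (H : TwoJet h ht hθ htt htθ hθθ) (K : TwoJet k kt kθ ktt ktθ kθθ) :
    ContDiff ℝ 1 (fun p : ℝ × ℝ => pohDensity β m h ht hθ k kt kθ p.1 p.2) := by
  have nh := H.contDiff.norm_sq ℝ
  have nk := K.contDiff.norm_sq ℝ
  refine ((contDiff_pohKin H).add (contDiff_pohKin K)).add ((hm.comp contDiff_fst).mul ?_)
  exact (contDiff_const.mul ((contDiff_const.sub ((nh.add nk).div_const 2)).pow 2)).add
    (contDiff_const.mul ((nh.sub nk).pow 2))

/-- Integrated Pohozaev identity on a cylinder. -/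
lemma pohozaev_identity {β : ℝ} {m m' κ : ℝ → ℝ} (hm : ContDiff ℝ 1 m)
    (hm' : ∀ t, HasDerivAt m (m' t) t)
    {h ht hθ htt htθ hθθ k kt kθ ktt ktθ kθθ : ℝ → ℝ → ℂ}
    (H : TwoJet h ht hθ htt htθ hθθ) (K : TwoJet k kt kθ ktt ktθ kθθ)
    (hper : ∀ t, ht t π = ht t (-π) ∧ hθ t π = hθ t (-π))
    (kper : ∀ t, kt t π = kt t (-π) ∧ kθ t π = kθ t (-π))
    (hpde : ∀ t θ, htt t θ = -(hθθ t θ) - (κ t) • ht t θ - h t θ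
      - (m t * (1 - (‖h t θ‖ ^ 2 + ‖k t θ‖ ^ 2) / 2
        - (β / 2) * (‖h t θ‖ ^ 2 - ‖k t θ‖ ^ 2))) • h t θ)
    (kpde : ∀ t θ, ktt t θ = -(kθθ t θ) - (κ t) • kt t θ - k t θ
      - (m t * (1 - (‖h t θ‖ ^ 2 + ‖k t θ‖ ^ 2) / 2
        + (β / 2) * (‖h t θ‖ ^ 2 - ‖k t θ‖ ^ 2))) • k t θ) (t₁ t₂ : ℝ) :
    ∫ t in t₁..t₂, ∫ θ in (-π)..π, (κ t * (‖ht t θ‖ ^ 2 + ‖kt t θ‖ ^ 2)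
        + m' t * spinorPot β (h t θ) (k t θ))
      = (∫ θ in (-π)..π, pohDensity β m h ht hθ k kt kθ t₂ θ)
        - ∫ θ in (-π)..π, pohDensity β m h ht hθ k kt kθ t₁ θ := by
  have ca := contDiff_pohDensity (β := β) hm H K
  have cb : ContDiff ℝ 1 (fun p : ℝ × ℝ =>
      -⟪hθ p.1 p.2, ht p.1 p.2⟫_ℝ + -⟪kθ p.1 p.2, kt p.1 p.2⟫_ℝ) :=
    ((H.contDiff_θ.inner ℝ H.contDiff_t).neg).add ((K.contDiff_θ.inner ℝ K.contDiff_t).neg)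
  refine cylinder_divergence ca cb (fun t => by simp only [(hper t).1, (hper t).2, (kper t).1,
    (kper t).2]) (fun t θ => ?_) t₁ t₂
  have nh := (H.deriv_t t θ).norm_sq
  have nk := (K.deriv_t t θ).norm_sq
  rw [fderiv_apply_fst ca (((hasDerivAt_pohKin H t θ).add (hasDerivAt_pohKin K t θ)).add
      ((hm' t).mul ((((hasDerivAt_const t (1 : ℝ)).sub ((nh.add nk).div_const 2)).pow 2
        |>.const_mul (1 / 2)).add (((nh.sub nk).pow 2).const_mul (β / 8))))),
    fderiv_apply_snd cb ((hasDerivAt_pohFlux H t θ).add (hasDerivAt_pohFlux K t θ)), hpde, kpde]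
  simp only [inner_sub_right, inner_neg_right, real_inner_smul_right, real_inner_self_eq_norm_sq,
    real_inner_comm (ht t θ), real_inner_comm (kt t θ), spinorPot, Pi.add_apply, Pi.sub_apply]
  push_cast
  ring

/-- A positive solution of the radial equation connecting `0` to `1` (in logarithmic radius)
is strictly increasing. -/
lemma profile_deriv_pos {F F' F'' : ℝ → ℝ} (hpos : ∀ t, 0 < F t)
    (hF : ∀ t, HasDerivAt F (F' t) t) (hF' : ∀ t, HasDerivAt F' (F'' t) t)
    (hode : ∀ t, F'' t = F t - Real.exp (2 * t) * (1 - F t ^ 2) * F t)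
    (h0 : Tendsto F atBot (𝓝 0)) (h1 : Tendsto F atTop (𝓝 1)) (t₀ : ℝ) : 0 < F' t₀ := by
  by_contra hneg
  push Not at hneg
  set q : ℝ → ℝ := fun t => 1 - F t ^ 2 - Real.exp (-2 * t) with hqdef
  have hexp : ∀ t : ℝ, Real.exp (2 * t) * Real.exp (-2 * t) = 1 := fun t => by
    rw [← Real.exp_add]; simp
  have hK : ∀ t, F'' t = -(F t * Real.exp (2 * t) * q t) := fun t => by
    rw [hode, hqdef]
    linear_combination (-F t) * hexp t
  have hq : ∀ t, HasDerivAt q (-2 * F t * F' t + 2 * Real.exp (-2 * t)) t := fun t => by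
    have e : HasDerivAt (fun t : ℝ => Real.exp (-2 * t)) (Real.exp (-2 * t) * (-2 * 1)) t :=
      ((hasDerivAt_id t).const_mul (-2)).exp
    convert! ((hasDerivAt_const t (1 : ℝ)).sub ((hF t).pow 2)).sub e using 1
    push_cast; ring
  have hqc : Continuous q := continuous_iff_continuousAt.2 fun t => (hq t).continuousAt
  have hFc : Continuous F := continuous_iff_continuousAt.2 fun t => (hF t).continuousAt
  have hKc : Continuous F' := continuous_iff_continuousAt.2 fun t => (hF' t).continuousAt
  have hqpos : ∀ t, F' t ≤ 0 → 0 < -2 * F t * F' t + 2 * Real.exp (-2 * t) := fun t ht => by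
    have := mul_nonneg (hpos t).le (neg_nonneg.2 ht)
    have := Real.exp_pos (-2 * t)
    nlinarith
  rcases lt_or_ge (q t₀) 0 with hq0 | hq0
  · -- going to the left, `q` stays negative and `F` stays decreasing
    have hKneg : ∀ s, (∀ t ∈ Ioc s t₀, q t < 0) → ∀ t ∈ Ico s t₀, F' t < 0 := by
      intro s hs t ht
      have hm : StrictMonoOn F' (Icc s t₀) := by
        refine strictMonoOn_of_deriv_pos (convex_Icc s t₀) hKc.continuousOn fun x hx => ?_
        rw [interior_Icc] at hx
        rw [(hF' x).deriv, hK]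
        have := mul_pos (mul_pos (hpos x) (Real.exp_pos (2 * x)))
          (neg_pos.2 (hs x ⟨hx.1, hx.2.le⟩))
        linarith
      exact lt_of_lt_of_le (hm ⟨ht.1, ht.2.le⟩ ⟨ht.1.trans ht.2.le, le_rfl⟩ ht.2) hneg
    have hall : ∀ s ≤ t₀, q s < 0 := by
      intro s hs
      by_contra hcon
      push Not at hcon
      have hcomp : IsCompact (Icc s t₀ ∩ {t | 0 ≤ q t}) :=
        isCompact_Icc.inter_right (isClosed_le continuous_const hqc)
      obtain ⟨r, ⟨hr, hrq⟩, hrmax⟩ := hcomp.exists_isGreatest ⟨s, ⟨le_rfl, hs⟩, hcon⟩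
      have hrt : r < t₀ := lt_of_le_of_ne hr.2 fun h => by
        rw [h] at hrq; exact absurd hrq (not_le.2 hq0)
      have hnegq : ∀ t ∈ Ioc r t₀, q t < 0 := fun t ht => by
        by_contra hc
        exact absurd (hrmax ⟨⟨hr.1.trans ht.1.le, ht.2⟩, not_lt.1 hc⟩) (not_le.2 ht.1)
      have hm : StrictMonoOn q (Icc r t₀) := by
        refine strictMonoOn_of_deriv_pos (convex_Icc r t₀) hqc.continuousOn fun x hx => ?_
        rw [interior_Icc] at hx
        rw [(hq x).deriv]
        exact hqpos x (hKneg r hnegq x ⟨hx.1.le, hx.2⟩).le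
      have h2 := hm ⟨le_rfl, hrt.le⟩ ⟨hrt.le, le_rfl⟩ hrt
      have h3 : 0 ≤ q r := hrq
      linarith
    have hanti : ∀ s ≤ t₀, F t₀ ≤ F s := by
      intro s hs
      have ha : AntitoneOn F (Icc s t₀) := by
        refine antitoneOn_of_deriv_nonpos (convex_Icc s t₀) hFc.continuousOn
          (fun x _ => (hF x).differentiableAt.differentiableWithinAt) fun x hx => ?_
        rw [interior_Icc] at hx
        rw [(hF x).deriv]
        exact (hKneg s (fun t ht => hall t ht.2) x ⟨hx.1.le, hx.2⟩).le
      exact ha ⟨le_rfl, hs⟩ ⟨hs, le_rfl⟩ hs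
    have := ge_of_tendsto h0 ((eventually_le_atBot t₀).mono hanti)
    linarith [hpos t₀]
  · -- going to the right, `q` is positive and increasing
    obtain ⟨a, ha0, haq⟩ : ∃ a > t₀, ∀ t ∈ Ioc t₀ a, q t₀ < q t := by
      have h := (hq t₀).tendsto_slope.eventually (lt_mem_nhds (hqpos t₀ hneg))
      have h' : ∀ᶠ t in 𝓝[>] t₀, 0 < slope q t₀ t :=
        h.filter_mono (nhdsWithin_mono _ fun x hx => ne_of_gt hx)
      obtain ⟨a, ha, hsub⟩ := mem_nhdsGT_iff_exists_Ioc_subset.1 h'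
      refine ⟨a, ha, fun t ht => ?_⟩
      have := hsub ht
      have h3 : 0 < slope q t₀ t := this
      rw [slope_def_field, div_pos_iff_of_pos_right (sub_pos.2 ht.1)] at h3
      linarith
    have hKneg : ∀ s, (∀ t ∈ Ioo t₀ s, 0 < q t) → ∀ t ∈ Icc t₀ s, F' t ≤ 0 := by
      intro s hs t ht
      have hm : AntitoneOn F' (Icc t₀ s) := by
        refine antitoneOn_of_deriv_nonpos (convex_Icc t₀ s) hKc.continuousOn
          (fun x _ => (hF' x).differentiableAt.differentiableWithinAt) fun x hx => ?_
        rw [interior_Icc] at hx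
        rw [(hF' x).deriv, hK]
        have := mul_pos (mul_pos (hpos x) (Real.exp_pos (2 * x))) (hs x hx)
        linarith
      exact (hm ⟨le_rfl, ht.1.trans ht.2⟩ ht ht.1).trans hneg
    have hmono : ∀ s, (∀ t ∈ Ioo t₀ s, 0 < q t) → StrictMonoOn q (Icc t₀ s) := by
      intro s hs
      refine strictMonoOn_of_deriv_pos (convex_Icc t₀ s) hqc.continuousOn fun x hx => ?_
      rw [interior_Icc] at hx
      rw [(hq x).deriv]
      exact hqpos x (hKneg s hs x ⟨hx.1.le, hx.2.le⟩)
    have hall : ∀ s > t₀, 0 < q s := by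
      intro s hs
      rcases le_or_gt s a with hsa | hsa
      · exact hq0.trans_lt (haq s ⟨hs, hsa⟩)
      by_contra hcon
      push Not at hcon
      have hcomp : IsCompact (Icc a s ∩ {t | q t ≤ 0}) :=
        isCompact_Icc.inter_right (isClosed_le hqc continuous_const)
      obtain ⟨r, ⟨hr, hrq⟩, hrmin⟩ := hcomp.exists_isLeast ⟨s, ⟨hsa.le, le_rfl⟩, hcon⟩
      have hposq : ∀ t ∈ Ioo t₀ r, 0 < q t := fun t ht => by
        rcases le_or_gt t a with hta | hta
        · exact hq0.trans_lt (haq t ⟨ht.1, hta⟩)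
        by_contra hc
        exact absurd (hrmin ⟨⟨hta.le, ht.2.le.trans hr.2⟩, not_lt.1 hc⟩) (not_le.2 ht.2)
      have htr : t₀ < r := ha0.trans_le hr.1
      have h2 := hmono r hposq ⟨le_rfl, htr.le⟩ ⟨htr.le, le_rfl⟩ htr
      have h3 : q r ≤ 0 := hrq
      linarith
    have hge : ∀ s ≥ a, q a ≤ q s := fun s hs =>
      (hmono s fun t ht => hall t ht.1).monotoneOn ⟨ha0.le, hs⟩ ⟨ha0.le.trans hs, le_rfl⟩ hs
    have hlim : Tendsto q atTop (𝓝 0) := by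
      have e : Tendsto (fun t : ℝ => Real.exp (-2 * t)) atTop (𝓝 0) :=
        Real.tendsto_exp_atBot.comp (tendsto_id.const_mul_atTop_of_neg (by norm_num))
      simpa [hqdef] using ((tendsto_const_nhds (x := (1 : ℝ))).sub (h1.pow 2)).sub e
    have := ge_of_tendsto hlim ((eventually_ge_atTop a).mono hge)
    linarith [hall a ha0]

/-- The quotient of the profile by the radius is nonincreasing. -/
lemma profile_div_exp_antitone {F F' F'' : ℝ → ℝ} (hpos : ∀ t, 0 < F t) (hlt : ∀ t, F t ≤ 1)
    (hF : ∀ t, HasDerivAt F (F' t) t) (hF' : ∀ t, HasDerivAt F' (F'' t) t)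
    (hode : ∀ t, F'' t = F t - Real.exp (2 * t) * (1 - F t ^ 2) * F t)
    (h0 : Tendsto F atBot (𝓝 0)) (h0' : Tendsto F' atBot (𝓝 0)) :
    Antitone (fun t => Real.exp (-t) * F t) := by
  have hG : ∀ t, HasDerivAt (fun t => Real.exp t * (F' t - F t))
      (Real.exp t * (F'' t - F t)) t := fun t => by
    convert! (Real.hasDerivAt_exp t).mul ((hF' t).sub (hF t)) using 1
    simp only [Pi.sub_apply]; ring
  have hGa : Antitone (fun t => Real.exp t * (F' t - F t)) := by
    refine antitone_of_deriv_nonpos (fun t => (hG t).differentiableAt) fun t => ?_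
    rw [(hG t).deriv, hode]
    have : 0 ≤ Real.exp t * (Real.exp (2 * t) * (1 - F t ^ 2) * F t) := by
      have := hpos t
      have : 0 ≤ 1 - F t ^ 2 := by nlinarith [hlt t]
      positivity
    linarith
  have hlim : Tendsto (fun t => Real.exp t * (F' t - F t)) atBot (𝓝 0) := by
    simpa using Real.tendsto_exp_atBot.mul (h0'.sub h0)
  have hle : ∀ t, F' t ≤ F t := fun t => by
    have := le_of_tendsto_of_tendsto tendsto_const_nhds hlim
      ((eventually_le_atBot t).mono fun s hs => hGa hs)
    have h2 := nonpos_of_mul_nonpos_right this (Real.exp_pos t)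
    linarith
  have hH : ∀ t, HasDerivAt (fun t => Real.exp (-t) * F t)
      (Real.exp (-t) * (F' t - F t)) t := fun t => by
    convert! ((hasDerivAt_id t).neg.exp).mul (hF t) using 1
    simp only [Pi.neg_apply, id]; ring
  refine antitone_of_deriv_nonpos (fun t => (hH t).differentiableAt) fun t => ?_
  rw [(hH t).deriv]
  exact mul_nonpos_of_nonneg_of_nonpos (Real.exp_pos _).le (sub_nonpos.2 (hle t))

/-- First-order expansion along rays, in logarithmic radius. -/
lemma tendsto_exp_neg_mul_comp_logPolar {ψ : ℂ → ℂ} (hψ : Differentiable ℝ ψ) {x₀ : ℂ}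
    (hz : ψ x₀ = 0) (θ : ℝ) :
    Tendsto (fun t => (Real.exp (-t) : ℂ) * ψ (x₀ + logPolar t θ)) atBot
      (𝓝 (fderiv ℝ ψ x₀ (logPolar 0 θ))) := by
  have h1 : HasDerivAt (fun s : ℝ => x₀ + (s : ℂ) * logPolar 0 θ) (logPolar 0 θ) 0 := by
    simpa using ((HasDerivAt.ofReal_comp (hasDerivAt_id (0 : ℝ))).mul_const
      (logPolar 0 θ)).const_add x₀
  have h0 : HasFDerivAt ψ (fderiv ℝ ψ x₀) (x₀ + ((0 : ℝ) : ℂ) * logPolar 0 θ) := by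
    simpa using (hψ x₀).hasFDerivAt
  have h2 := (h0.comp_hasDerivAt (0 : ℝ) h1).tendsto_slope_zero_right.comp
    Real.tendsto_exp_atBot_nhdsGT
  refine h2.congr fun t => ?_
  simp [hz, Real.exp_neg, logPolar_eq t θ]

/-- `ψ` grows at most linearly near a zero. -/
lemma norm_le_mul_norm_of_zero {ψ : ℂ → ℂ} (hψ : ContDiff ℝ 1 ψ) {x₀ : ℂ} (hz : ψ x₀ = 0) :
    ∃ M : ℝ, 0 ≤ M ∧ ∀ z : ℂ, ‖z‖ ≤ 1 →
      ‖ψ (x₀ + z)‖ ≤ M * ‖z‖ ∧ ‖fderiv ℝ ψ (x₀ + z)‖ ≤ M := by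
  obtain ⟨M, hM⟩ := (isCompact_closedBall x₀ 1).exists_bound_of_continuousOn
    (hψ.continuous_fderiv (by norm_num)).continuousOn
  have hmem : ∀ z : ℂ, ‖z‖ ≤ 1 → x₀ + z ∈ closedBall x₀ 1 := fun z hz => by simpa using hz
  refine ⟨M, (norm_nonneg _).trans (hM x₀ (by simp)), fun z hz1 => ⟨?_, hM _ (hmem z hz1)⟩⟩
  have := (convex_closedBall x₀ 1).norm_image_sub_le_of_norm_fderiv_le (𝕜 := ℝ) (f := ψ)
    (fun x _ => hψ.differentiable (by norm_num) x) hM (by simp : x₀ ∈ closedBall x₀ 1)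
    (hmem z hz1)
  simpa [hz] using this

/-- Rotating a circle by a quarter turn does not change circular integrals. -/
lemma integral_quarter_turn {g : ℂ → ℝ} :
    ∫ θ in (-π)..π, g (Complex.I * logPolar 0 θ) = ∫ θ in (-π)..π, g (logPolar 0 θ) := by
  have hI : ∀ θ, Complex.I * logPolar 0 θ = logPolar 0 (θ + π / 2) := fun θ => by
    simp only [logPolar]
    push_cast
    rw [add_mul, ← add_assoc, Complex.exp_add _ ((π : ℂ) / 2 * Complex.I),
      Complex.exp_pi_div_two_mul_I]
    ring
  have hp : Function.Periodic (fun θ => g (logPolar 0 θ)) (2 * π) := fun θ => by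
    simp only [logPolar]
    push_cast
    rw [add_mul, ← add_assoc, Complex.exp_add _ (2 * (π : ℂ) * Complex.I),
      Complex.exp_two_pi_mul_I, mul_one]
  simp only [hI]
  rw [intervalIntegral.integral_comp_add_right (fun θ => g (logPolar 0 θ))]
  have := hp.intervalIntegral_add_eq (-π + π / 2) (-π)
  rw [show -π + π / 2 + 2 * π = π + π / 2 by ring, show -π + 2 * π = π by ring] at this
  exact this

/-- The kinetic flux at a common zero vanishes. -/
lemma tendsto_integral_pohKin_atBot {ψ : ℂ → ℂ} (hψ : ContDiff ℝ 2 ψ) {x₀ : ℂ} (hz : ψ x₀ = 0)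
    {c c' : ℝ → ℝ} {γ : ℝ} (hc : Tendsto (fun t => Real.exp t * c t) atBot (𝓝 γ))
    (hc' : Tendsto (fun t => Real.exp t * c' t) atBot (𝓝 (-γ))) :
    Tendsto (fun t => ∫ θ in (-π)..π, pohKin
      (fun t θ => (c t : ℂ) * ψ (x₀ + logPolar t θ))
      (fun t θ => (c t : ℂ) * fderiv ℝ ψ (x₀ + logPolar t θ) (logPolar t θ)
        + (c' t : ℂ) * ψ (x₀ + logPolar t θ))
      (fun t θ => (c t : ℂ) * fderiv ℝ ψ (x₀ + logPolar t θ) (Complex.I * logPolar t θ)) t θ)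
      atBot (𝓝 0) := by
  have hψ1 : ContDiff ℝ 1 ψ := hψ.of_le (by norm_num)
  have hd : Differentiable ℝ ψ := hψ.differentiable (by norm_num)
  have hDc : Continuous (fderiv ℝ ψ) := hψ1.continuous_fderiv (by norm_num)
  set L := fderiv ℝ ψ x₀ with hL
  have hee : ∀ t : ℝ, (Real.exp t : ℂ) * (Real.exp (-t) : ℂ) = 1 := fun t => by
    rw [← Complex.ofReal_mul, ← Real.exp_add]; simp
  have hlim0 : ∀ θ, Tendsto (fun t => x₀ + logPolar t θ) atBot (𝓝 x₀) := fun θ => by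
    have : Tendsto (fun t => logPolar t θ) atBot (𝓝 0) := by
      rw [tendsto_zero_iff_norm_tendsto_zero]
      simpa only [norm_logPolar] using Real.tendsto_exp_atBot
    simpa using this.const_add x₀
  have hDlim : ∀ v θ, Tendsto (fun t => fderiv ℝ ψ (x₀ + logPolar t θ) v) atBot (𝓝 (L v)) :=
    fun v θ => ((ContinuousLinearMap.apply ℝ ℂ v).continuous.tendsto L).comp
      ((hDc.tendsto x₀).comp (hlim0 θ))
  have hcC : Tendsto (fun t => ((Real.exp t * c t : ℝ) : ℂ)) atBot (𝓝 (γ : ℂ)) :=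
    (Complex.continuous_ofReal.tendsto _).comp hc
  have hcC' : Tendsto (fun t => ((Real.exp t * c' t : ℝ) : ℂ)) atBot (𝓝 ((-γ : ℝ) : ℂ)) :=
    (Complex.continuous_ofReal.tendsto _).comp hc'
  have e0 : ∀ (b : ℝ → ℝ) t θ, (b t : ℂ) * ψ (x₀ + logPolar t θ)
      = ((Real.exp t * b t : ℝ) : ℂ) * ((Real.exp (-t) : ℂ) * ψ (x₀ + logPolar t θ)) := by
    intro b t θ
    have h2 := hee t
    push_cast at h2 ⊢
    linear_combination (-(b t : ℂ) * ψ (x₀ + logPolar t θ)) * h2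
  have e1 : ∀ t θ, (c t : ℂ) * fderiv ℝ ψ (x₀ + logPolar t θ) (logPolar t θ)
      = ((Real.exp t * c t : ℝ) : ℂ) * fderiv ℝ ψ (x₀ + logPolar t θ) (logPolar 0 θ) := by
    intro t θ
    have h1 : logPolar t θ = Real.exp t • logPolar 0 θ := by
      rw [logPolar_eq t θ, Complex.real_smul]
    have : ∀ A : ℂ →L[ℝ] ℂ, A (logPolar t θ) = (Real.exp t : ℂ) * A (logPolar 0 θ) := fun A => by
      rw [h1, map_smul, Complex.real_smul]
    rw [this]; push_cast; ring
  have e2 : ∀ t θ, (c t : ℂ) * fderiv ℝ ψ (x₀ + logPolar t θ) (Complex.I * logPolar t θ)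
      = ((Real.exp t * c t : ℝ) : ℂ)
        * fderiv ℝ ψ (x₀ + logPolar t θ) (Complex.I * logPolar 0 θ) := by
    intro t θ
    have h1 : Complex.I * logPolar t θ = Real.exp t • (Complex.I * logPolar 0 θ) := by
      rw [logPolar_eq t θ, Complex.real_smul]; ring
    rw [h1, map_smul, Complex.real_smul]; push_cast; ring
  have hU := fun θ => tendsto_exp_neg_mul_comp_logPolar hd hz θ
  have hpt : ∀ θ, Tendsto (fun t => pohKin
      (fun t θ => (c t : ℂ) * ψ (x₀ + logPolar t θ))
      (fun t θ => (c t : ℂ) * fderiv ℝ ψ (x₀ + logPolar t θ) (logPolar t θ)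
        + (c' t : ℂ) * ψ (x₀ + logPolar t θ))
      (fun t θ => (c t : ℂ) * fderiv ℝ ψ (x₀ + logPolar t θ) (Complex.I * logPolar t θ)) t θ)
      atBot (𝓝 ((γ ^ 2 / 2) * ‖L (Complex.I * logPolar 0 θ)‖ ^ 2
        - (γ ^ 2 / 2) * ‖L (logPolar 0 θ)‖ ^ 2)) := by
    intro θ
    have A := ((hcC.mul (hDlim (logPolar 0 θ) θ)).add (hcC'.mul (hU θ))).norm.pow 2
    have B := (hcC.mul (hDlim (Complex.I * logPolar 0 θ) θ)).norm.pow 2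
    have C := (hcC.mul (hU θ)).norm.pow 2
    have := ((A.neg.add B).sub C).const_mul (1 / 2 : ℝ)
    simp only [pohKin, e2, e1, e0 c, e0 c']
    have z : (γ : ℂ) * L (logPolar 0 θ) + ((-γ : ℝ) : ℂ) * L (logPolar 0 θ) = 0 := by
      push_cast; ring
    convert! this using 2
    rw [z]
    simp only [norm_mul, Complex.norm_real, mul_pow, norm_zero, Real.norm_eq_abs, sq_abs]
    ring
  obtain ⟨M, hM0, hM⟩ := norm_le_mul_norm_of_zero hψ1 hz
  set G := |γ| + 1
  have hG : 0 ≤ G := by positivity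
  have hcb : ∀ᶠ t in atBot, |Real.exp t * c t| ≤ G :=
    (hc.abs.eventually (gt_mem_nhds (lt_add_one |γ|))).mono fun t ht => ht.le
  have hcb' : ∀ᶠ t in atBot, |Real.exp t * c' t| ≤ G :=
    (hc'.abs.eventually (gt_mem_nhds (by rw [abs_neg]; exact lt_add_one |γ|))).mono
      fun t ht => ht.le
  have hzero : ∫ θ in (-π)..π, ((γ ^ 2 / 2) * ‖L (Complex.I * logPolar 0 θ)‖ ^ 2
      - (γ ^ 2 / 2) * ‖L (logPolar 0 θ)‖ ^ 2) = 0 := by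
    have hl : Continuous (fun θ => logPolar 0 θ) :=
      continuous_logPolar.comp (continuous_const.prodMk continuous_id)
    rw [intervalIntegral.integral_sub, sub_eq_zero]
    · exact integral_quarter_turn (g := fun z => (γ ^ 2 / 2) * ‖L z‖ ^ 2)
    · exact (continuous_const.mul ((L.continuous.comp
        (continuous_const.mul hl)).norm.pow 2)).intervalIntegrable _ _
    · exact (continuous_const.mul ((L.continuous.comp hl).norm.pow 2)).intervalIntegrable _ _
  rw [← hzero]
  refine intervalIntegral.tendsto_integral_filter_of_dominated_convergence
    (fun _ => (1 / 2) * ((G * M + G * M) ^ 2 + (G * M) ^ 2 + (G * M) ^ 2)) ?_ ?_ ?_ ?_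
  · refine Eventually.of_forall fun t => Continuous.aestronglyMeasurable ?_
    have hl : Continuous (fun θ => logPolar t θ) :=
      continuous_logPolar.comp (continuous_const.prodMk continuous_id)
    have hl0 : Continuous (fun θ => x₀ + logPolar t θ) := continuous_const.add hl
    have h1 : Continuous (fun θ => ψ (x₀ + logPolar t θ)) := hψ.continuous.comp hl0
    have h2 : Continuous (fun θ => fderiv ℝ ψ (x₀ + logPolar t θ) (logPolar t θ)) :=
      (hDc.comp hl0).clm_apply hl
    have h3 : Continuous (fun θ => fderiv ℝ ψ (x₀ + logPolar t θ) (Complex.I * logPolar t θ)) :=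
      (hDc.comp hl0).clm_apply (continuous_const.mul hl)
    unfold pohKin
    fun_prop
  · filter_upwards [hcb, hcb', eventually_le_atBot 0] with t h1 h2 h3
    refine Eventually.of_forall fun θ _ => ?_
    have hn : ‖logPolar t θ‖ ≤ 1 := by rw [norm_logPolar]; simpa using h3
    have hn0 : ‖logPolar 0 θ‖ = 1 := by rw [norm_logPolar]; simp
    have u1 : ‖(Real.exp (-t) : ℂ) * ψ (x₀ + logPolar t θ)‖ ≤ M := by
      rw [norm_mul, Complex.norm_real, Real.norm_eq_abs, Real.abs_exp]
      have := (hM _ hn).1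
      rw [norm_logPolar] at this
      calc Real.exp (-t) * ‖ψ (x₀ + logPolar t θ)‖ ≤ Real.exp (-t) * (M * Real.exp t) := by gcongr
        _ = M * (Real.exp (-t) * Real.exp t) := by ring
        _ = M := by rw [← Real.exp_add]; simp
    have u2 : ‖fderiv ℝ ψ (x₀ + logPolar t θ) (logPolar 0 θ)‖ ≤ M := by
      have := (fderiv ℝ ψ (x₀ + logPolar t θ)).le_opNorm (logPolar 0 θ)
      rw [hn0, mul_one] at this
      exact this.trans (hM _ hn).2
    have u3 : ‖fderiv ℝ ψ (x₀ + logPolar t θ) (Complex.I * logPolar 0 θ)‖ ≤ M := by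
      have := (fderiv ℝ ψ (x₀ + logPolar t θ)).le_opNorm (Complex.I * logPolar 0 θ)
      rw [norm_mul, Complex.norm_I, hn0, mul_one, mul_one] at this
      exact this.trans (hM _ hn).2
    have bd : ∀ (r : ℝ) (w : ℂ), |r| ≤ G → ‖w‖ ≤ M → ‖(r : ℂ) * w‖ ≤ G * M := fun r w hr hw => by
      rw [norm_mul, Complex.norm_real]
      exact mul_le_mul hr hw (norm_nonneg _) hG
    simp only [pohKin, e2, e1, e0 c, e0 c']
    have b1 := bd _ _ h1 u1
    have b1' := bd _ _ h2 u1
    have b2 := bd _ _ h1 u2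
    have b3 := bd _ _ h1 u3
    have b4 := (norm_add_le _ _).trans (add_le_add b2 b1')
    have s1 := pow_le_pow_left₀ (norm_nonneg _) b1 2
    have s3 := pow_le_pow_left₀ (norm_nonneg _) b3 2
    have s4 := pow_le_pow_left₀ (norm_nonneg _) b4 2
    rw [Real.norm_eq_abs, abs_le]
    constructor <;> nlinarith [sq_nonneg (G * M), sq_nonneg (G * M + G * M)]
  · exact intervalIntegrable_const
  · exact Eventually.of_forall fun θ _ => hpt θ

lemma logPolar_log {r : ℝ} (hr : 0 < r) (θ : ℝ) :
    logPolar (Real.log r) θ = Complex.polarCoord.symm (r, θ) := by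
  rw [logPolar_eq, Real.exp_log hr, Complex.polarCoord_symm_apply, logPolar]
  simp [Complex.exp_mul_I]

/-- In polar coordinates about any point, a function integrable near infinity is integrable
against the polar weight. -/
lemma integrableOn_polar_of_integrableOn {g : ℂ → ℝ} {R : ℝ}
    (hgc : ContinuousOn g {x | R < ‖x‖}) (hgi : IntegrableOn g {x | R ≤ ‖x‖}) (x₀ : ℂ)
    {r₁ : ℝ} (h0 : 0 < r₁) (h1 : R + ‖x₀‖ ≤ r₁) :
    IntegrableOn (fun p : ℝ × ℝ => p.1 * g (x₀ + logPolar (Real.log p.1) p.2))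
      (Ioi r₁ ×ˢ Ioo (-π) π) := by
  have hms : MeasurableSet (Ioi r₁ ×ˢ Ioo (-π) π) := measurableSet_Ioi.prod measurableSet_Ioo
  have hsub : Ioi r₁ ×ˢ Ioo (-π) π ⊆ polarCoord.target := fun p hp => ⟨h0.trans hp.1, hp.2⟩
  have hfar : ∀ p ∈ Ioi r₁ ×ˢ Ioo (-π) π, R < ‖x₀ + logPolar (Real.log p.1) p.2‖ := by
    intro p hp
    have hp1 : r₁ < p.1 := hp.1
    have h2 := norm_sub_le (x₀ + logPolar (Real.log p.1) p.2) x₀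
    rw [add_sub_cancel_left, norm_logPolar, Real.exp_log (h0.trans hp1)] at h2
    linarith
  refine ⟨ContinuousOn.aestronglyMeasurable (continuousOn_fst.mul (hgc.comp ?_ hfar)) hms, ?_⟩
  · refine continuousOn_const.add (continuous_logPolar.comp_continuousOn (.prodMk ?_ continuousOn_snd))
    exact Real.continuousOn_log.comp continuousOn_fst fun p hp => (h0.trans hp.1).ne'
  · set G : ℂ → ENNReal := fun z => {x : ℂ | R ≤ ‖x‖}.indicator (fun x => ‖g x‖ₑ) (x₀ + z)
    have hms' : MeasurableSet {x : ℂ | R ≤ ‖x‖} :=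
      (isClosed_le continuous_const continuous_norm).measurableSet
    have hfin : ∫⁻ z, G z < ⊤ := by
      rw [lintegral_add_left_eq_self (fun x => {x : ℂ | R ≤ ‖x‖}.indicator (fun x => ‖g x‖ₑ) x) x₀,
        lintegral_indicator hms']
      exact hgi.2
    rw [← Complex.lintegral_comp_polarCoord_symm] at hfin
    refine lt_of_le_of_lt ?_ hfin
    refine (setLIntegral_mono_ae' hms (Eventually.of_forall fun p hp => ?_)).trans
      (lintegral_mono_set hsub)
    have hp0 : 0 < p.1 := h0.trans hp.1
    have hf := hfar p hp
    simp only [G]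
    rw [logPolar_log hp0] at hf ⊢
    rw [indicator_of_mem (show _ ∈ {x : ℂ | R ≤ ‖x‖} from hf.le), enorm_mul,
      Real.enorm_of_nonneg hp0.le, smul_eq_mul]

/-- The circular means of an integrable function decay along a sequence of radii. -/
lemma exists_circle_integral_lt {g : ℂ → ℝ} {R : ℝ}
    (hgc : ContinuousOn g {x | R < ‖x‖}) (hgi : IntegrableOn g {x | R ≤ ‖x‖}) (x₀ : ℂ)
    {δ : ℝ} (hδ : 0 < δ) (T : ℝ) :
    ∃ t > T, Real.exp (2 * t) * ∫ θ in (-π)..π, g (x₀ + logPolar t θ) < δ := by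
  by_contra! hcon
  set r₁ := max (Real.exp T) (R + ‖x₀‖)
  have h0 : 0 < r₁ := (Real.exp_pos T).trans_le (le_max_left _ _)
  have h := integrableOn_polar_of_integrableOn hgc hgi x₀ h0 (le_max_right _ _)
  rw [IntegrableOn, Measure.volume_eq_prod, ← Measure.prod_restrict] at h
  refine not_integrableOn_Ioi_inv (a := r₁) ?_
  refine (h.integral_prod_left.const_mul δ⁻¹).mono' (by fun_prop) ?_
  rw [ae_restrict_iff' measurableSet_Ioi]
  refine Eventually.of_forall fun r hr => ?_
  have hr0 : 0 < r := h0.trans hr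
  have h2 := hcon (Real.log r) ((Real.lt_log_iff_exp_lt hr0).2 ((le_max_left _ _).trans_lt hr))
  rw [two_mul, Real.exp_add, Real.exp_log hr0, intervalIntegral.integral_of_le (by linarith [Real.pi_pos]),
    integral_Ioc_eq_integral_Ioo] at h2
  rw [integral_const_mul, Real.norm_of_nonneg (inv_nonneg.2 hr0.le), inv_mul_eq_div, le_div_iff₀ hδ,
    inv_mul_le_iff₀ hr0]
  linarith

/-- A complex function of degree one at infinity, with modulus `ρ` and phase correction `χ`. -/
structure UnitDegreeAtInfty (ψ : ℂ → ℂ) (ρ χ : ℂ → ℝ) (R₀ c φ : ℝ) : Prop where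
  R₀_pos : 0 < R₀
  contDiffOn_modulus : ContDiffOn ℝ 1 ρ {x : ℂ | R₀ ≤ ‖x‖}
  contDiffOn_phase : ContDiffOn ℝ 1 χ {x : ℂ | R₀ ≤ ‖x‖}
  modulus_pos : ∀ x : ℂ, R₀ ≤ ‖x‖ → 0 < ρ x
  eq_polar : ∀ x : ℂ, R₀ ≤ ‖x‖ →
    ψ x = (ρ x : ℂ) * Complex.exp (Complex.I * ((Complex.arg x + χ x : ℝ) : ℂ))
  modulus_sub_le : ∀ x : ℂ, R₀ ≤ ‖x‖ → |ρ x - 1 / Real.sqrt 2| ≤ c / ‖x‖ ^ 2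
  norm_fderiv_modulus_le : ∀ x : ℂ, R₀ ≤ ‖x‖ → ‖fderiv ℝ ρ x‖ ≤ c / ‖x‖ ^ 3
  phase_lim : ∀ δ > (0 : ℝ), ∃ M : ℝ, ∀ x : ℂ, M ≤ ‖x‖ → |χ x - φ| < δ

lemma exp_I_mul_arg {z : ℂ} (hz : z ≠ 0) :
    Complex.exp (Complex.I * (Complex.arg z : ℂ)) = z / (‖z‖ : ℂ) := by
  rw [eq_div_iff (by exact_mod_cast norm_ne_zero_iff.2 hz), mul_comm, mul_comm Complex.I]
  exact Complex.norm_mul_exp_arg_mul_I z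

namespace UnitDegreeAtInfty

variable {ψ : ℂ → ℂ} {ρ χ : ℂ → ℝ} {R₀ c φ : ℝ}

lemma norm_eq (H : UnitDegreeAtInfty ψ ρ χ R₀ c φ) {x : ℂ} (hx : R₀ ≤ ‖x‖) : ‖ψ x‖ = ρ x := by
  rw [H.eq_polar x hx, norm_mul, mul_comm Complex.I, Complex.norm_exp_ofReal_mul_I, mul_one,
    Complex.norm_real, Real.norm_of_nonneg (H.modulus_pos x hx).le]

lemma isOpen_region : IsOpen {x : ℂ | R₀ < ‖x‖} := isOpen_lt continuous_const continuous_norm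

lemma continuousOn_fderiv_phase (H : UnitDegreeAtInfty ψ ρ χ R₀ c φ) :
    ContinuousOn (fderiv ℝ χ) {x : ℂ | R₀ < ‖x‖} :=
  (H.contDiffOn_phase.mono fun x (hx : R₀ < ‖x‖) => hx.le).continuousOn_fderiv_of_isOpen
    isOpen_region le_rfl

lemma norm_fderiv_apply_le (H : UnitDegreeAtInfty ψ ρ χ R₀ c φ) (hψ : Differentiable ℝ ψ) {x : ℂ}
    (hx : R₀ < ‖x‖) (v : ℂ) :
    ‖fderiv ℝ ψ x v‖ ≤ ‖fderiv ℝ ρ x‖ * ‖v‖ + ρ x * (‖v‖ / ‖x‖)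
      + ρ x * (‖fderiv ℝ χ x‖ * ‖v‖) := by
  have hnhds : {x : ℂ | R₀ < ‖x‖} ∈ 𝓝 x := isOpen_region.mem_nhds hx
  have hnhds' : {x : ℂ | R₀ ≤ ‖x‖} ∈ 𝓝 x := mem_of_superset hnhds fun y (hy : R₀ < ‖y‖) => hy.le
  have hx0 : x ≠ 0 := norm_pos_iff.1 (H.R₀_pos.trans hx)
  have hline : HasDerivAt (fun s : ℝ => x + (s : ℂ) * v) v 0 := by
    simpa using ((HasDerivAt.ofReal_comp (hasDerivAt_id (0 : ℝ))).mul_const v).const_add x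
  have hl0 : x + ((0 : ℝ) : ℂ) * v = x := by simp
  have along : ∀ {E : Type} [NormedAddCommGroup E] [NormedSpace ℝ E] {g : ℂ → E},
      DifferentiableAt ℝ g x → HasDerivAt (fun s : ℝ => g (x + (s : ℂ) * v)) (fderiv ℝ g x v) 0 := by
    intro E _ _ g hg
    have : HasFDerivAt g (fderiv ℝ g x) (x + ((0 : ℝ) : ℂ) * v) := by
      rw [hl0]; exact hg.hasFDerivAt
    exact this.comp_hasDerivAt (0 : ℝ) hline
  have dρ := along ((H.contDiffOn_modulus.contDiffAt hnhds').differentiableAt (by norm_num))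
  have dχ := along ((H.contDiffOn_phase.contDiffAt hnhds').differentiableAt (by norm_num))
  have dψ := along (hψ x)
  have dlog : HasDerivAt (fun s : ℝ => Complex.log ((x + (s : ℂ) * v) / x)) (v / x) 0 := by
    have := (hline.div_const x).clog_real (by rw [hl0, div_self hx0]; exact Complex.one_mem_slitPlane)
    rwa [hl0, div_self hx0, div_one] at this
  have darg : HasDerivAt (fun s : ℝ => (Complex.log ((x + (s : ℂ) * v) / x)).im) (v / x).im 0 :=
    Complex.imCLM.hasFDerivAt.comp_hasDerivAt (0 : ℝ) dlog
  have dmain := ((dρ.ofReal_comp).mul_const (Complex.exp (Complex.I * (Complex.arg x : ℂ)))).mul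
    (((darg.add dχ).ofReal_comp).const_mul Complex.I).cexp
  have heq : (fun s : ℝ => ψ (x + (s : ℂ) * v)) =ᶠ[𝓝 0] fun s : ℝ =>
      ((ρ (x + (s : ℂ) * v) : ℂ) * Complex.exp (Complex.I * (Complex.arg x : ℂ)))
        * Complex.exp (Complex.I * (((Complex.log ((x + (s : ℂ) * v) / x)).im
          + χ (x + (s : ℂ) * v) : ℝ) : ℂ)) := by
    have : ∀ᶠ s : ℝ in 𝓝 0, R₀ < ‖x + (s : ℂ) * v‖ := by
      have h := hline.continuousAt.tendsto
      rw [hl0] at h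
      exact h hnhds
    filter_upwards [this] with s hs
    have hs0 : x + (s : ℂ) * v ≠ 0 := norm_pos_iff.1 (H.R₀_pos.trans hs)
    rw [H.eq_polar _ hs.le, Complex.log_im]
    push_cast
    rw [mul_add, mul_add, Complex.exp_add, Complex.exp_add, exp_I_mul_arg hs0, exp_I_mul_arg hx0,
      exp_I_mul_arg (div_ne_zero hs0 hx0), norm_div]
    have n1 : (‖x‖ : ℂ) ≠ 0 := by exact_mod_cast norm_ne_zero_iff.2 hx0
    have n2 : (‖x + (s : ℂ) * v‖ : ℂ) ≠ 0 := by exact_mod_cast norm_ne_zero_iff.2 hs0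
    push_cast
    field_simp
  have key := dψ.unique (dmain.congr_of_eventuallyEq heq)
  have hexp : ∀ r : ℝ, ‖Complex.exp (Complex.I * (r : ℂ))‖ = 1 := fun r => by
    rw [mul_comm, Complex.norm_exp_ofReal_mul_I]
  have hρ := (H.modulus_pos x hx.le).le
  rw [key]
  simp only [hl0]
  refine (norm_add_le _ _).trans ?_
  have e1 := (fderiv ℝ ρ x).le_opNorm v
  have e2 := (fderiv ℝ χ x).le_opNorm v
  have e3 : |(v / x).im| ≤ ‖v‖ / ‖x‖ := by rw [← norm_div]; exact Complex.abs_im_le_norm _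
  have e4 : |(v / x).im + fderiv ℝ χ x v| ≤ ‖v‖ / ‖x‖ + ‖fderiv ℝ χ x‖ * ‖v‖ :=
    (abs_add_le _ _).trans (add_le_add e3 e2)
  simp only [norm_mul, hexp, Complex.norm_real, Complex.norm_I, mul_one, one_mul,
    Real.norm_of_nonneg hρ, Real.norm_eq_abs]
  rw [Real.norm_eq_abs] at e1
  nlinarith [mul_le_mul_of_nonneg_left e4 hρ]

lemma modulus_le_one (H : UnitDegreeAtInfty ψ ρ χ R₀ c φ) :
    ∀ᶠ r : ℝ in atTop, ∀ x : ℂ, ‖x‖ = r → ρ x ≤ 1 := by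
  have h1 : Tendsto (fun r : ℝ => 1 / Real.sqrt 2 + c / r ^ 2) atTop (𝓝 (1 / Real.sqrt 2 + 0)) :=
    tendsto_const_nhds.add (tendsto_const_nhds.div_atTop (tendsto_pow_atTop (by norm_num)))
  have h2 : 1 / Real.sqrt 2 + 0 < 1 := by
    rw [add_zero, div_lt_one (by positivity)]
    exact Real.lt_sqrt_of_sq_lt (by norm_num)
  filter_upwards [h1.eventually (gt_mem_nhds h2), eventually_ge_atTop R₀] with r hr hR x hx
  have := (abs_le.1 (H.modulus_sub_le x (hx ▸ hR))).2
  rw [hx] at this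
  linarith

/-- The angular kinetic energy exceeds its limit value only through the phase gradient. -/
lemma angular_energy_le (H : UnitDegreeAtInfty ψ ρ χ R₀ c φ) (hψ : Differentiable ℝ ψ) (x₀ : ℂ)
    {ε : ℝ} (hε : 0 < ε) :
    ∃ C ≥ (0 : ℝ), ∀ᶠ r : ℝ in atTop, ∀ x : ℂ, ‖x‖ = r →
      ‖fderiv ℝ ψ x (Complex.I * (x - x₀))‖ ^ 2 - ‖ψ x‖ ^ 2
        ≤ ε + C * (‖x - x₀‖ ^ 2 * ‖fderiv ℝ χ x‖ ^ 2) := by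
  set η := min 1 (ε / 5)
  have hη : 0 < η := lt_min one_pos (by positivity)
  have hη1 : η ≤ 1 := min_le_left _ _
  have hηε : 5 * η ≤ ε := by linarith [min_le_right 1 (ε / 5)]
  refine ⟨2 + 1 / η, by positivity, ?_⟩
  have hlim : Tendsto (fun r : ℝ => c / r ^ 2 + c * ‖x₀‖ / r ^ 3 + ‖x₀‖ / r) atTop
      (𝓝 (0 + 0 + 0)) :=
    ((tendsto_const_nhds.div_atTop (tendsto_pow_atTop (by norm_num))).add
      (tendsto_const_nhds.div_atTop (tendsto_pow_atTop (by norm_num)))).add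
      (tendsto_const_nhds.div_atTop tendsto_id)
  filter_upwards [hlim.eventually (gt_mem_nhds (by simpa using hη)), eventually_gt_atTop R₀,
    H.modulus_le_one] with r hr hR h1 x hx
  subst hx
  have hρ1 := h1 x rfl
  have hρ := H.modulus_pos x hR.le
  have hx0 : 0 < ‖x‖ := H.R₀_pos.trans hR
  have hv : ‖Complex.I * (x - x₀)‖ = ‖x - x₀‖ := by simp
  have hv' : ‖x - x₀‖ ≤ ‖x‖ + ‖x₀‖ := norm_sub_le _ _
  have hb := H.norm_fderiv_apply_le hψ hR (Complex.I * (x - x₀))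
  rw [hv] at hb
  rw [H.norm_eq hR.le]
  set y := ‖x - x₀‖ * ‖fderiv ℝ χ x‖
  have hy : 0 ≤ y := by positivity
  have hdρ := H.norm_fderiv_modulus_le x hR.le
  have a1 : ‖fderiv ℝ ρ x‖ * ‖x - x₀‖ ≤ c / ‖x‖ ^ 2 + c * ‖x₀‖ / ‖x‖ ^ 3 := by
    calc ‖fderiv ℝ ρ x‖ * ‖x - x₀‖ ≤ c / ‖x‖ ^ 3 * (‖x‖ + ‖x₀‖) :=
          mul_le_mul hdρ hv' (norm_nonneg _) ((norm_nonneg _).trans hdρ)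
      _ = c / ‖x‖ ^ 2 + c * ‖x₀‖ / ‖x‖ ^ 3 := by field_simp
  have a2 : ρ x * (‖x - x₀‖ / ‖x‖) ≤ ρ x + ‖x₀‖ / ‖x‖ := by
    have : ‖x - x₀‖ / ‖x‖ ≤ 1 + ‖x₀‖ / ‖x‖ := by
      rw [div_le_iff₀ hx0]; field_simp; linarith
    have h2 : 0 ≤ ‖x₀‖ / ‖x‖ := by positivity
    nlinarith
  have a3 : ρ x * (‖fderiv ℝ χ x‖ * ‖x - x₀‖) ≤ y := by
    rw [mul_comm ‖fderiv ℝ χ x‖]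
    exact mul_le_of_le_one_left hy hρ1
  have hb2 : ‖fderiv ℝ ψ x (Complex.I * (x - x₀))‖ ≤ η + ρ x + y := by linarith
  have hsq := pow_le_pow_left₀ (norm_nonneg _) hb2 2
  rw [← mul_pow]
  change _ ≤ ε + (2 + 1 / η) * y ^ 2
  have hyη : 2 * y ≤ η + 1 / η * y ^ 2 := by
    have : 0 ≤ (1 / η) * (η - y) ^ 2 := by positivity
    have h2 : (1 / η) * (η - y) ^ 2 = η + 1 / η * y ^ 2 - 2 * y := by field_simp; ring
    linarith
  nlinarith [sq_nonneg (η - y), mul_nonneg hρ.le hy, mul_nonneg (sub_nonneg.2 hρ1) hy]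

/-- The modulus defect is of lower order than the inverse radius. -/
lemma modulus_defect_le (H : UnitDegreeAtInfty ψ ρ χ R₀ c φ) (x₀ : ℂ) {ε : ℝ} (hε : 0 < ε) :
    ∀ᶠ r : ℝ in atTop, ∀ x : ℂ, ‖x‖ = r → ‖x - x₀‖ * |2 * ‖ψ x‖ ^ 2 - 1| ≤ ε := by
  have hlim : Tendsto (fun r : ℝ => 4 * c / r + 4 * c * ‖x₀‖ / r ^ 2) atTop (𝓝 (0 + 0)) :=
    (tendsto_const_nhds.div_atTop tendsto_id).add
      (tendsto_const_nhds.div_atTop (tendsto_pow_atTop (by norm_num)))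
  filter_upwards [hlim.eventually (gt_mem_nhds (by simpa using hε)), eventually_gt_atTop R₀,
    H.modulus_le_one] with r hr hR h1 x hx
  subst hx
  have hρ1 := h1 x rfl
  have hρ := H.modulus_pos x hR.le
  have hx0 : 0 < ‖x‖ := H.R₀_pos.trans hR
  rw [H.norm_eq hR.le]
  have hs : (1 / Real.sqrt 2) ^ 2 = 1 / 2 := by rw [div_pow, Real.sq_sqrt (by norm_num)]; norm_num
  have hs0 : 0 < 1 / Real.sqrt 2 := by positivity
  have hs1 : 1 / Real.sqrt 2 ≤ 1 := by nlinarith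
  have hm := H.modulus_sub_le x hR.le
  have e : 2 * ρ x ^ 2 - 1 = 2 * (ρ x - 1 / Real.sqrt 2) * (ρ x + 1 / Real.sqrt 2) := by
    linear_combination 2 * hs
  have b : |2 * ρ x ^ 2 - 1| ≤ 4 * (c / ‖x‖ ^ 2) := by
    rw [e, abs_mul, abs_mul, abs_of_pos (add_pos hρ hs0), abs_two]
    have := abs_nonneg (ρ x - 1 / Real.sqrt 2)
    nlinarith
  calc ‖x - x₀‖ * |2 * ρ x ^ 2 - 1| ≤ (‖x‖ + ‖x₀‖) * (4 * (c / ‖x‖ ^ 2)) :=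
        mul_le_mul (norm_sub_le _ _) b (abs_nonneg _) (by positivity)
    _ = 4 * c / ‖x‖ + 4 * c * ‖x₀‖ / ‖x‖ ^ 2 := by field_simp
    _ ≤ ε := hr.le

/-- Radial limits of a function of degree one at infinity. -/
lemma tendsto_comp_logPolar (H : UnitDegreeAtInfty ψ ρ χ R₀ c φ) (x₀ : ℂ) (θ : ℝ) :
    Tendsto (fun t => ψ (x₀ + logPolar t θ)) atTop
      (𝓝 ((Real.sqrt 2 : ℂ)⁻¹ * (logPolar 0 θ * Complex.exp (Complex.I * (φ : ℂ))))) := by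
  have hn : Tendsto (fun t => ‖x₀ + logPolar t θ‖) atTop atTop := by
    refine tendsto_atTop_mono (fun t => ?_) (tendsto_atTop_add_const_right _ (-‖x₀‖)
      Real.tendsto_exp_atTop)
    have := norm_sub_le (x₀ + logPolar t θ) x₀
    rw [add_sub_cancel_left, norm_logPolar] at this
    linarith
  have hρ : Tendsto (fun t => ρ (x₀ + logPolar t θ)) atTop (𝓝 (1 / Real.sqrt 2)) := by
    rw [tendsto_iff_norm_sub_tendsto_zero]
    refine squeeze_zero' (Eventually.of_forall fun t => norm_nonneg _)
      ((hn.eventually_ge_atTop R₀).mono fun t ht => H.modulus_sub_le _ ht) ?_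
    exact (tendsto_const_nhds.div_atTop (tendsto_pow_atTop (by norm_num))).comp hn
  have hχ : Tendsto (fun t => χ (x₀ + logPolar t θ)) atTop (𝓝 φ) := by
    rw [Metric.tendsto_nhds]
    intro δ hδ
    obtain ⟨M, hM⟩ := H.phase_lim δ hδ
    exact (hn.eventually_ge_atTop M).mono fun t ht => hM _ ht
  have hd : Tendsto (fun t => (Real.exp (-t) : ℂ) * x₀ + logPolar 0 θ) atTop
      (𝓝 (logPolar 0 θ)) := by
    have h1 : Tendsto (fun t : ℝ => ((Real.exp (-t) : ℝ) : ℂ)) atTop (𝓝 ((0 : ℝ) : ℂ)) :=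
      (Complex.continuous_ofReal.tendsto _).comp
        (Real.tendsto_exp_atBot.comp tendsto_neg_atTop_atBot)
    simpa using (h1.mul_const x₀).add_const (logPolar 0 θ)
  have hl0 : ‖logPolar 0 θ‖ = 1 := by rw [norm_logPolar]; simp
  have hdir := hd.div ((Complex.continuous_ofReal.tendsto _).comp hd.norm)
    (by rw [hl0]; norm_num)
  have hexp := ((Complex.continuous_ofReal.tendsto _).comp hχ).const_mul Complex.I |>.cexp
  have hmain := ((Complex.continuous_ofReal.tendsto _).comp hρ).mul (hdir.mul hexp)
  have hlimeq : ((1 / Real.sqrt 2 : ℝ) : ℂ) * (logPolar 0 θ / ((‖logPolar 0 θ‖ : ℝ) : ℂ)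
      * Complex.exp (Complex.I * (φ : ℂ)))
      = (Real.sqrt 2 : ℂ)⁻¹ * (logPolar 0 θ * Complex.exp (Complex.I * (φ : ℂ))) := by
    rw [hl0]; simp
  rw [← hlimeq]
  refine hmain.congr' ?_
  filter_upwards [hn.eventually_ge_atTop R₀] with t ht
  have hx0 : x₀ + logPolar t θ ≠ 0 := norm_pos_iff.1 (H.R₀_pos.trans_le ht)
  rw [H.eq_polar _ ht, Complex.ofReal_add, mul_add, Complex.exp_add, exp_I_mul_arg hx0]
  simp only [Function.comp_apply, Pi.div_apply]
  have hz : x₀ + logPolar t θ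
      = (Real.exp t : ℂ) * ((Real.exp (-t) : ℂ) * x₀ + logPolar 0 θ) := by
    rw [mul_add, ← mul_assoc, ← Complex.ofReal_mul, ← Real.exp_add, ← logPolar_eq]; simp
  have he : (Real.exp t : ℂ) ≠ 0 := by exact_mod_cast (Real.exp_pos t).ne'
  have hdd : (x₀ + logPolar t θ) / (‖x₀ + logPolar t θ‖ : ℂ)
      = ((Real.exp (-t) : ℂ) * x₀ + logPolar 0 θ)
        / (‖(Real.exp (-t) : ℂ) * x₀ + logPolar 0 θ‖ : ℂ) := by
    rw [hz, norm_mul, Complex.norm_real, Real.norm_of_nonneg (Real.exp_pos t).le]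
    rw [Complex.ofReal_mul, mul_div_mul_left _ _ he]
  rw [hdd]

end UnitDegreeAtInfty

/-- The radial profile of an equivariant solution of degree one, in logarithmic radius. -/
structure LogProfile (F F' F'' : ℝ → ℝ) (a : ℝ) : Prop where
  pos : ∀ t, 0 < F t
  lt_one : ∀ t, F t < 1
  contDiff : ContDiff ℝ 1 F
  contDiff_deriv : ContDiff ℝ 1 F'
  hasDerivAt : ∀ t, HasDerivAt F (F' t) t
  hasDerivAt_deriv : ∀ t, HasDerivAt F' (F'' t) t
  ode : ∀ t, F'' t = F t - Real.exp (2 * t) * (1 - F t ^ 2) * F t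
  deriv_pos : ∀ t, 0 < F' t
  slope_pos : 0 < a
  tendsto_div_exp : Tendsto (fun t => Real.exp (-t) * F t) atBot (𝓝 a)
  tendsto_deriv_div_exp : Tendsto (fun t => Real.exp (-t) * F' t) atBot (𝓝 a)
  tendsto_atTop : Tendsto F atTop (𝓝 1)
  tendsto_exp_mul_defect : Tendsto (fun t => Real.exp t * |F t ^ 2 - 1|) atTop (𝓝 0)

lemma exists_logProfile {f : ℝ → ℝ} (hf0 : f 0 = 0) (hfpos : ∀ r > (0 : ℝ), 0 < f r)
    {C r₁ : ℝ} (hasym : ∀ r : ℝ, r₁ ≤ r → |f r - 1| ≤ C / r ^ 2) {u : ℂ → ℂ}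
    (hu : ∀ x : ℂ, u x = (f ‖x‖ : ℂ) * Complex.exp (Complex.I * (Complex.arg x : ℂ)))
    (huC2 : ContDiff ℝ 2 u)
    (huSol : ∀ x : ℂ, -lap u x = ((1 - ‖u x‖ ^ 2 : ℝ) : ℂ) * u x) :
    ∃ (F' F'' : ℝ → ℝ) (a : ℝ), LogProfile (fun t => f (Real.exp t)) F' F'' a := by
  set F : ℝ → ℝ := fun t => f (Real.exp t) with hFdef
  have hul : ∀ t θ, u (0 + logPolar t θ) = (F t : ℂ) * logPolar 0 θ := by
    intro t θ
    have hz : logPolar t θ ≠ 0 := Complex.exp_ne_zero _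
    rw [zero_add, hu, exp_I_mul_arg hz, norm_logPolar, logPolar_eq t θ,
      mul_div_cancel_left₀ _ (by exact_mod_cast (Real.exp_pos t).ne')]
  have hl00 : logPolar 0 0 = 1 := by simp [logPolar]
  have hu0 : u 0 = 0 := by rw [hu]; simp [hf0]
  have J := twoJet_logPolar huC2 0
  have hud : Differentiable ℝ u := huC2.differentiable (by norm_num)
  set F' : ℝ → ℝ := fun t => (fderiv ℝ u (0 + logPolar t 0) (logPolar t 0)).re with hF'def
  set F'' : ℝ → ℝ := fun t => (fderiv ℝ (fderiv ℝ u) (0 + logPolar t 0) (logPolar t 0)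
    (logPolar t 0) + fderiv ℝ u (0 + logPolar t 0) (logPolar t 0)).re with hF''def
  have hFre : F = fun t => (u (0 + logPolar t 0)).re := by
    funext t; rw [hul, hl00]; simp
  have hinl : ContDiff ℝ 1 (fun t : ℝ => (t, (0 : ℝ))) := contDiff_id.prodMk contDiff_const
  have hFC : ContDiff ℝ 1 F := by
    rw [hFre]; exact Complex.reCLM.contDiff.comp (J.contDiff.comp hinl)
  have hFC' : ContDiff ℝ 1 F' := Complex.reCLM.contDiff.comp (J.contDiff_t.comp hinl)
  have hF : ∀ t, HasDerivAt F (F' t) t := fun t => by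
    rw [hFre]; exact Complex.reCLM.hasFDerivAt.comp_hasDerivAt t (J.deriv_t t 0)
  have hF' : ∀ t, HasDerivAt F' (F'' t) t := fun t =>
    Complex.reCLM.hasFDerivAt.comp_hasDerivAt t (J.deriv_tt t 0)
  have hpos : ∀ t, 0 < F t := fun t => hfpos _ (Real.exp_pos t)
  have hode : ∀ t, F'' t = F t - Real.exp (2 * t) * (1 - F t ^ 2) * F t := by
    intro t
    have hθ : ∀ θ, fderiv ℝ u (0 + logPolar t θ) (Complex.I * logPolar t θ)
        = (F t : ℂ) * (Complex.I * logPolar 0 θ) := fun θ => by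
      refine (J.deriv_θ t θ).unique ?_
      simp only [hul]
      exact (hasDerivAt_logPolar_snd 0 θ).const_mul _
    have hθθ := J.deriv_θθ t 0
    simp only [hθ] at hθθ
    have hθθ' := hθθ.unique
      (((hasDerivAt_logPolar_snd 0 0).const_mul Complex.I).const_mul (F t : ℂ))
    have hlap := logPolar_laplacian huC2 0 t 0
    rw [hθθ', hl00, mul_one, Complex.I_mul_I, neg_eq_iff_eq_neg.1 (huSol _), hul, hl00, mul_one,
      Complex.norm_real, Real.norm_eq_abs, sq_abs] at hlap
    have := congrArg Complex.re hlap
    rw [Complex.add_re] at this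
    change F'' t + _ = _ at this
    rw [← Complex.ofReal_mul, ← Complex.ofReal_neg, ← Complex.ofReal_mul, Complex.ofReal_re] at this
    simp at this
    linarith
  have hlimE : Tendsto (fun t => Real.exp (-t) * F t) atBot (𝓝 (fderiv ℝ u 0 1).re) := by
    have h := (Complex.continuous_re.tendsto _).comp (tendsto_exp_neg_mul_comp_logPolar hud hu0 0)
    rw [hl00] at h
    refine h.congr fun t => ?_
    simp only [Function.comp_apply]
    rw [hul, hl00, mul_one, ← Complex.ofReal_mul, Complex.ofReal_re]
  have hlimE' : Tendsto (fun t => Real.exp (-t) * F' t) atBot (𝓝 (fderiv ℝ u 0 1).re) := by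
    have hDc : Continuous (fun z => (fderiv ℝ u z 1).re) := Complex.continuous_re.comp
      ((huC2.continuous_fderiv (by norm_num)).clm_apply continuous_const)
    have hz : Tendsto (fun t => logPolar t 0) atBot (𝓝 0) := by
      rw [tendsto_zero_iff_norm_tendsto_zero]
      simpa only [norm_logPolar] using Real.tendsto_exp_atBot
    refine ((hDc.tendsto 0).comp hz).congr fun t => ?_
    have h1 : logPolar t 0 = Real.exp t • (1 : ℂ) := by
      rw [logPolar_eq t 0, hl00, Complex.real_smul]
    have h2 : ∀ A : ℂ →L[ℝ] ℂ, (A (logPolar t 0)).re = Real.exp t * (A 1).re := fun A => by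
      rw [h1, map_smul, Complex.smul_re, smul_eq_mul]
    simp only [Function.comp_apply, hF'def]
    rw [h2, ← mul_assoc, ← Real.exp_add, neg_add_cancel, Real.exp_zero, one_mul, zero_add]
  have of_div : ∀ {G : ℝ → ℝ} {b : ℝ}, Tendsto (fun t => Real.exp (-t) * G t) atBot (𝓝 b) →
      Tendsto G atBot (𝓝 0) := fun {G b} h => by
    have := Real.tendsto_exp_atBot.mul h
    rw [zero_mul] at this
    refine this.congr fun t => ?_
    rw [← mul_assoc, ← Real.exp_add, add_neg_cancel, Real.exp_zero, one_mul]
  have hdefect : ∀ᶠ t in atTop, |F t - 1| ≤ C * Real.exp (-t) ^ 2 := by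
    filter_upwards [Real.tendsto_exp_atTop.eventually_ge_atTop r₁] with t ht
    have := hasym _ ht
    rwa [div_eq_mul_inv, ← inv_pow, ← Real.exp_neg] at this
  have hexp0 : Tendsto (fun t : ℝ => Real.exp (-t)) atTop (𝓝 0) :=
    Real.tendsto_exp_atBot.comp tendsto_neg_atTop_atBot
  have h1 : Tendsto F atTop (𝓝 1) := by
    rw [tendsto_iff_norm_sub_tendsto_zero]
    refine squeeze_zero' (Eventually.of_forall fun t => norm_nonneg _) hdefect ?_
    simpa using (hexp0.pow 2).const_mul C
  have hF'pos := profile_deriv_pos hpos hF hF' hode (of_div hlimE) h1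
  have hmono : StrictMono F := strictMono_of_deriv_pos fun t => by
    rw [(hF t).deriv]; exact hF'pos t
  have hlt : ∀ t, F t < 1 := fun t =>
    (hmono (lt_add_one t)).trans_le (hmono.monotone.ge_of_tendsto h1 _)
  have hanti := profile_div_exp_antitone hpos (fun t => (hlt t).le) hF hF' hode (of_div hlimE)
    (of_div hlimE')
  refine ⟨F', F'', _, hpos, hlt, hFC, hFC', hF, hF', hode, hF'pos, ?_, hlimE, hlimE', h1, ?_⟩
  · have := ge_of_tendsto hlimE ((eventually_le_atBot 0).mono fun s hs => hanti hs)
    have h0 := hpos 0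
    simp only [neg_zero, Real.exp_zero, one_mul] at this
    linarith
  · refine squeeze_zero' (g := fun t => 2 * C * Real.exp (-t))
      (Eventually.of_forall fun t => by positivity) ?_ (by simpa using hexp0.const_mul (2 * C))
    filter_upwards [hdefect] with t ht
    have e : Real.exp t * Real.exp (-t) = 1 := by rw [← Real.exp_add]; simp
    have hp := hpos t
    have hl := hlt t
    rw [show F t ^ 2 - 1 = (F t - 1) * (F t + 1) by ring, abs_mul, abs_of_pos (add_pos hp one_pos)]
    have h3 : |F t - 1| * (F t + 1) ≤ (C * Real.exp (-t) ^ 2) * 2 :=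
      mul_le_mul ht (by linarith) (by linarith) ((abs_nonneg _).trans ht)
    calc Real.exp t * (|F t - 1| * (F t + 1)) ≤ Real.exp t * ((C * Real.exp (-t) ^ 2) * 2) :=
          mul_le_mul_of_nonneg_left h3 (Real.exp_pos t).le
      _ = 2 * C * Real.exp (-t) := by linear_combination (2 * C * Real.exp (-t)) * e

/-- A nonnegative continuous function with vanishing double integrals vanishes. -/
lemma eq_zero_of_integral2_eq_zero {Q : ℝ → ℝ → ℝ} (hQ : Continuous (fun p : ℝ × ℝ => Q p.1 p.2))
    (h0 : ∀ t θ, 0 ≤ Q t θ) (hint : ∀ t₁ t₂, ∫ t in t₁..t₂, ∫ θ in (-π)..π, Q t θ = 0)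
    {t θ : ℝ} (hθ : θ ∈ Icc (-π) π) : Q t θ = 0 := by
  by_contra hne
  have hpi : -π < π := by linarith [Real.pi_pos]
  have hin : Continuous (fun t => ∫ θ in (-π)..π, Q t θ) :=
    intervalIntegral.continuous_parametric_intervalIntegral_of_continuous' hQ _ _
  have h1 : 0 < ∫ θ in (-π)..π, Q t θ :=
    intervalIntegral.integral_pos hpi
      (hQ.comp (continuous_const.prodMk continuous_id)).continuousOn (fun x _ => h0 t x)
      ⟨θ, hθ, lt_of_le_of_ne (h0 t θ) (Ne.symm hne)⟩
  have h2 : 0 < ∫ t in (t - 1)..(t + 1), ∫ θ in (-π)..π, Q t θ :=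
    intervalIntegral.integral_pos (by linarith) hin.continuousOn
      (fun s _ => intervalIntegral.integral_nonneg hpi.le fun x _ => h0 s x)
      ⟨t, ⟨by linarith, by linarith⟩, h1⟩
  exact h2.ne' (hint _ _)

/-- The quotient of `ψ` by the normalized profile, in logarithmic polar coordinates. -/
def quo (F : ℝ → ℝ) (ψ : ℂ → ℂ) (x₀ : ℂ) (t θ : ℝ) : ℂ :=
  ((Real.sqrt 2 * (F t)⁻¹ : ℝ) : ℂ) * ψ (x₀ + logPolar t θ)

/-- The radial derivative of `quo`. -/
def quoT (F F' : ℝ → ℝ) (ψ : ℂ → ℂ) (x₀ : ℂ) (t θ : ℝ) : ℂ :=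
  ((Real.sqrt 2 * (F t)⁻¹ : ℝ) : ℂ) * fderiv ℝ ψ (x₀ + logPolar t θ) (logPolar t θ)
    + ((Real.sqrt 2 * (-F' t / F t ^ 2) : ℝ) : ℂ) * ψ (x₀ + logPolar t θ)

/-- The angular derivative of `quo`. -/
def quoΘ (F : ℝ → ℝ) (ψ : ℂ → ℂ) (x₀ : ℂ) (t θ : ℝ) : ℂ :=
  ((Real.sqrt 2 * (F t)⁻¹ : ℝ) : ℂ)
    * fderiv ℝ ψ (x₀ + logPolar t θ) (Complex.I * logPolar t θ)

lemma quo_jet {F F' F'' : ℝ → ℝ} {a : ℝ} (P : LogProfile F F' F'' a) {ψ : ℂ → ℂ}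
    (hψ : ContDiff ℝ 2 ψ) (x₀ : ℂ) :
    ∃ htt htθ hθθ, TwoJet (quo F ψ x₀) (quoT F F' ψ x₀) (quoΘ F ψ x₀) htt htθ hθθ ∧
      ∀ (V t θ : ℝ), -lap ψ (x₀ + logPolar t θ) = (V : ℂ) * ψ (x₀ + logPolar t θ) →
        htt t θ = -(hθθ t θ) - (2 * F' t / F t) • quoT F F' ψ x₀ t θ - quo F ψ x₀ t θ
          - (Real.exp (2 * t) * (V - 1 + F t ^ 2)) • quo F ψ x₀ t θ := by
  have hne : ∀ t, F t ≠ 0 := fun t => (P.pos t).ne'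
  have hc : ∀ t, HasDerivAt (fun t => Real.sqrt 2 * (F t)⁻¹) (Real.sqrt 2 * (-F' t / F t ^ 2)) t :=
    fun t => ((P.hasDerivAt t).inv (hne t)).const_mul _
  have hc' : ∀ t, HasDerivAt (fun t => Real.sqrt 2 * (-F' t / F t ^ 2))
      (Real.sqrt 2 * (-F'' t / F t ^ 2 + 2 * F' t ^ 2 / F t ^ 3)) t := fun t => by
    convert! (((P.hasDerivAt_deriv t).neg.div ((P.hasDerivAt t).pow 2)
      (pow_ne_zero 2 (hne t))).const_mul (Real.sqrt 2)) using 1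
    have := hne t
    simp only [Pi.neg_apply, Pi.pow_apply]
    field_simp
    push_cast
    ring
  have J := (twoJet_logPolar hψ x₀).smul_fst hc hc' (contDiff_const.mul (P.contDiff.inv hne))
    (contDiff_const.mul (P.contDiff_deriv.neg.div (P.contDiff.pow 2)
      fun t => pow_ne_zero 2 (hne t)))
  refine ⟨_, _, _, J, fun V t θ hV => ?_⟩
  have hlap := logPolar_laplacian hψ x₀ t θ
  rw [neg_eq_iff_eq_neg.1 hV] at hlap
  have hF : (F t : ℂ) ≠ 0 := by exact_mod_cast hne t
  simp only [quo, quoT, Complex.real_smul, P.ode t]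
  rw [← eq_sub_iff_add_eq] at hlap
  rw [hlap]
  push_cast
  field_simp
  ring

/-- The Pohozaev flux of the pair of quotients through a circle. -/
def pohFlux (β : ℝ) (F F' : ℝ → ℝ) (ψp ψm : ℂ → ℂ) (x₀ : ℂ) (t : ℝ) : ℝ :=
  ∫ θ in (-π)..π, pohDensity β (fun t => F t ^ 2 * Real.exp (2 * t)) (quo F ψp x₀)
    (quoT F F' ψp x₀) (quoΘ F ψp x₀) (quo F ψm x₀) (quoT F F' ψm x₀) (quoΘ F ψm x₀) t θ

/-- The (nonnegative) dissipation density in the Pohozaev identity. -/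
def pohDissipation (β : ℝ) (F F' : ℝ → ℝ) (ψp ψm : ℂ → ℂ) (x₀ : ℂ) (t θ : ℝ) : ℝ :=
  (2 * F' t / F t) * (‖quoT F F' ψp x₀ t θ‖ ^ 2 + ‖quoT F F' ψm x₀ t θ‖ ^ 2)
    + (2 * F t * F' t * Real.exp (2 * t) + F t ^ 2 * (2 * Real.exp (2 * t)))
      * spinorPot β (quo F ψp x₀ t θ) (quo F ψm x₀ t θ)

lemma pohDissipation_nonneg {β : ℝ} (hβ : 0 < β) {F F' F'' : ℝ → ℝ} {a : ℝ}
    (P : LogProfile F F' F'' a) (ψp ψm : ℂ → ℂ) (x₀ : ℂ) (t θ : ℝ) :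
    0 ≤ pohDissipation β F F' ψp ψm x₀ t θ := by
  have := P.pos t
  have := P.deriv_pos t
  have := spinorPot_nonneg hβ (quo F ψp x₀ t θ) (quo F ψm x₀ t θ)
  unfold pohDissipation
  positivity

lemma continuous_pohDissipation {β : ℝ} {F F' F'' : ℝ → ℝ} {a : ℝ} (P : LogProfile F F' F'' a)
    {ψp ψm : ℂ → ℂ} (hp : ContDiff ℝ 2 ψp) (hm : ContDiff ℝ 2 ψm) (x₀ : ℂ) :
    Continuous (fun p : ℝ × ℝ => pohDissipation β F F' ψp ψm x₀ p.1 p.2) := by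
  obtain ⟨_, _, _, J, -⟩ := quo_jet P hp x₀
  obtain ⟨_, _, _, K, -⟩ := quo_jet P hm x₀
  have a1 := J.contDiff.continuous
  have a2 := J.contDiff_t.continuous
  have b1 := K.contDiff.continuous
  have b2 := K.contDiff_t.continuous
  have f1 : Continuous (fun p : ℝ × ℝ => F p.1) := P.contDiff.continuous.comp continuous_fst
  have f2 : Continuous (fun p : ℝ × ℝ => F' p.1) := P.contDiff_deriv.continuous.comp continuous_fst
  have f3 : Continuous (fun p : ℝ × ℝ => 2 * F' p.1 / F p.1) :=
    (continuous_const.mul f2).div f1 fun p => (P.pos p.1).ne'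
  have f4 : Continuous (fun p : ℝ × ℝ => Real.exp (2 * p.1)) := by fun_prop
  exact (f3.mul ((a2.norm.pow 2).add (b2.norm.pow 2))).add
    (((((continuous_const.mul f1).mul f2).mul f4).add ((f1.pow 2).mul (continuous_const.mul f4))).mul
      ((continuous_const.mul ((continuous_const.sub
        (((a1.norm.pow 2).add (b1.norm.pow 2)).div_const 2)).pow 2)).add
        (continuous_const.mul (((a1.norm.pow 2).sub (b1.norm.pow 2)).pow 2))))

lemma pohFlux_sub {β : ℝ} {F F' F'' : ℝ → ℝ} {a : ℝ} (P : LogProfile F F' F'' a)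
    {ψp ψm : ℂ → ℂ} (hsol : EntireSolution β ψp ψm) (x₀ : ℂ) (t₁ t₂ : ℝ) :
    ∫ t in t₁..t₂, ∫ θ in (-π)..π, pohDissipation β F F' ψp ψm x₀ t θ
      = pohFlux β F F' ψp ψm x₀ t₂ - pohFlux β F F' ψp ψm x₀ t₁ := by
  obtain ⟨hp, hm, ep, em, -⟩ := hsol
  obtain ⟨_, _, _, J, hJ⟩ := quo_jet P hp x₀
  obtain ⟨_, _, _, K, hK⟩ := quo_jet P hm x₀
  have hn : ∀ (ψ : ℂ → ℂ) t θ, ‖quo F ψ x₀ t θ‖ ^ 2 * F t ^ 2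
      = 2 * ‖ψ (x₀ + logPolar t θ)‖ ^ 2 := fun ψ t θ => by
    have := (P.pos t).ne'
    rw [quo, norm_mul, Complex.norm_real, mul_pow, Real.norm_eq_abs, sq_abs, mul_pow,
      Real.sq_sqrt (by norm_num)]
    field_simp
  have hexp : ∀ t : ℝ, HasDerivAt (fun t : ℝ => Real.exp (2 * t)) (2 * Real.exp (2 * t)) t :=
    fun t => by simpa [mul_comm] using ((hasDerivAt_id t).const_mul 2).exp
  refine pohozaev_identity (κ := fun t => 2 * F' t / F t)
    (m' := fun t => 2 * F t * F' t * Real.exp (2 * t) + F t ^ 2 * (2 * Real.exp (2 * t)))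
    ((P.contDiff.pow 2).mul (by fun_prop)) (fun t => ?_) J K
    (fun t => by simp only [quoT, quoΘ, logPolar_pi, and_self])
    (fun t => by simp only [quoT, quoΘ, logPolar_pi, and_self]) (fun t θ => ?_) (fun t θ => ?_) t₁ t₂
  · convert! ((P.hasDerivAt t).pow 2).mul (hexp t) using 1
    simp
  · rw [hJ (1 - (‖ψp (x₀ + logPolar t θ)‖ ^ 2 + ‖ψm (x₀ + logPolar t θ)‖ ^ 2)
      + β * (‖ψm (x₀ + logPolar t θ)‖ ^ 2 - ‖ψp (x₀ + logPolar t θ)‖ ^ 2)) t θ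
      (by rw [ep]; push_cast; ring)]
    congr 2
    linear_combination Real.exp (2 * t) * (1 / 2 + β / 2) * hn ψp t θ
      + Real.exp (2 * t) * (1 / 2 - β / 2) * hn ψm t θ
  · rw [hK (1 - (‖ψp (x₀ + logPolar t θ)‖ ^ 2 + ‖ψm (x₀ + logPolar t θ)‖ ^ 2)
      - β * (‖ψm (x₀ + logPolar t θ)‖ ^ 2 - ‖ψp (x₀ + logPolar t θ)‖ ^ 2)) t θ
      (by rw [em]; push_cast; ring)]
    congr 2
    linear_combination Real.exp (2 * t) * (1 / 2 - β / 2) * hn ψp t θ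
      + Real.exp (2 * t) * (1 / 2 + β / 2) * hn ψm t θ

lemma pohFlux_mono {β : ℝ} (hβ : 0 < β) {F F' F'' : ℝ → ℝ} {a : ℝ} (P : LogProfile F F' F'' a)
    {ψp ψm : ℂ → ℂ} (hsol : EntireSolution β ψp ψm) (x₀ : ℂ) :
    Monotone (pohFlux β F F' ψp ψm x₀) := fun t₁ t₂ h => by
  rw [← sub_nonneg, ← pohFlux_sub P hsol]
  exact intervalIntegral.integral_nonneg h fun t _ =>
    intervalIntegral.integral_nonneg (by linarith [Real.pi_pos]) fun θ _ =>
      pohDissipation_nonneg hβ P ψp ψm x₀ t θ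

lemma pohFlux_nonneg {β : ℝ} (hβ : 0 < β) {F F' F'' : ℝ → ℝ} {a : ℝ} (P : LogProfile F F' F'' a)
    {ψp ψm : ℂ → ℂ} (hsol : EntireSolution β ψp ψm) {x₀ : ℂ} (hzp : ψp x₀ = 0) (hzm : ψm x₀ = 0)
    (t : ℝ) : 0 ≤ pohFlux β F F' ψp ψm x₀ t := by
  have hpi : -π ≤ π := by linarith [Real.pi_pos]
  have hp := hsol.1
  have hm := hsol.2.1
  have ha := P.slope_pos.ne'
  have hd := P.tendsto_div_exp
  have hc : Tendsto (fun t => Real.exp t * (Real.sqrt 2 * (F t)⁻¹)) atBot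
      (𝓝 (Real.sqrt 2 * a⁻¹)) := by
    refine ((hd.inv₀ ha).const_mul (Real.sqrt 2)).congr fun t => ?_
    rw [mul_inv, Real.exp_neg, inv_inv]; ring
  have hc' : Tendsto (fun t => Real.exp t * (Real.sqrt 2 * (-F' t / F t ^ 2))) atBot
      (𝓝 (-(Real.sqrt 2 * a⁻¹))) := by
    have := ((P.tendsto_deriv_div_exp.mul ((hd.inv₀ ha).pow 2)).const_mul (Real.sqrt 2)).neg
    have e : -(Real.sqrt 2 * (a * a⁻¹ ^ 2)) = -(Real.sqrt 2 * a⁻¹) := by field_simp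
    rw [e] at this
    refine this.congr fun t => ?_
    have := (P.pos t).ne'
    rw [Real.exp_neg]
    have := (Real.exp_pos t).ne'
    field_simp
  have hlim := (tendsto_integral_pohKin_atBot hp hzp hc hc').add
    (tendsto_integral_pohKin_atBot hm hzm hc hc')
  rw [add_zero] at hlim
  refine le_of_tendsto hlim ((eventually_le_atBot t).mono fun s hs => ?_)
  refine le_trans ?_ (pohFlux_mono hβ P hsol x₀ hs)
  obtain ⟨_, _, _, J, -⟩ := quo_jet P hp x₀
  obtain ⟨_, _, _, K, -⟩ := quo_jet P hm x₀
  have hinl : Continuous (fun θ : ℝ => (s, θ)) := continuous_const.prodMk continuous_id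
  have hexp : ContDiff ℝ 1 (fun t => F t ^ 2 * Real.exp (2 * t)) :=
    (P.contDiff.pow 2).mul (by fun_prop)
  have iJ := ((contDiff_pohKin J).continuous.comp hinl).intervalIntegrable (μ := volume) (-π) π
  have iK := ((contDiff_pohKin K).continuous.comp hinl).intervalIntegrable (μ := volume) (-π) π
  have iP := ((contDiff_pohDensity (β := β) hexp J K).continuous.comp hinl).intervalIntegrable
    (μ := volume) (-π) π
  refine (intervalIntegral.integral_add iJ iK).symm.le.trans ?_
  refine intervalIntegral.integral_mono_on hpi (iJ.add iK) iP fun θ _ => ?_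
  have h1 := spinorPot_nonneg hβ (quo F ψp x₀ s θ) (quo F ψm x₀ s θ)
  have h2 : 0 ≤ F s ^ 2 * Real.exp (2 * s) * spinorPot β (quo F ψp x₀ s θ) (quo F ψm x₀ s θ) := by
    positivity
  exact le_add_of_nonneg_right h2

lemma eventually_logPolar {Q : ℂ → Prop} (h : ∀ᶠ r : ℝ in atTop, ∀ x : ℂ, ‖x‖ = r → Q x) (x₀ : ℂ) :
    ∀ᶠ t : ℝ in atTop, ∀ θ, Q (x₀ + logPolar t θ) := by
  obtain ⟨M, hM⟩ := eventually_atTop.1 h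
  filter_upwards [Real.tendsto_exp_atTop.eventually_ge_atTop (M + ‖x₀‖)] with t ht θ
  refine hM _ ?_ _ rfl
  have := norm_sub_le (x₀ + logPolar t θ) x₀
  rw [add_sub_cancel_left, norm_logPolar] at this
  linarith

lemma LogProfile.eventually_half_le_sq {F F' F'' : ℝ → ℝ} {a : ℝ} (P : LogProfile F F' F'' a) :
    ∀ᶠ t in atTop, 1 / 2 ≤ F t ^ 2 :=
  ((P.tendsto_atTop.pow 2).eventually (lt_mem_nhds (by norm_num : (1 / 2 : ℝ) < 1 ^ 2))).mono
    fun _ ht => ht.le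

lemma pohKin_quo_le {F F' F'' : ℝ → ℝ} {a : ℝ} (P : LogProfile F F' F'' a) {ψ : ℂ → ℂ}
    {ρ χ : ℂ → ℝ} {R₀ c φ : ℝ} (H : UnitDegreeAtInfty ψ ρ χ R₀ c φ) (hψ : Differentiable ℝ ψ)
    (x₀ : ℂ) {ε : ℝ} (hε : 0 < ε) :
    ∃ C ≥ (0 : ℝ), ∀ᶠ t in atTop, ∀ θ, pohKin (quo F ψ x₀) (quoT F F' ψ x₀) (quoΘ F ψ x₀) t θ
      ≤ ε + C * (Real.exp (2 * t) * ‖fderiv ℝ χ (x₀ + logPolar t θ)‖ ^ 2) := by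
  obtain ⟨C, hC, hev⟩ := H.angular_energy_le hψ x₀ (half_pos hε)
  refine ⟨2 * C, by positivity, ?_⟩
  filter_upwards [eventually_logPolar hev x₀, P.eventually_half_le_sq] with t ht hF θ
  have h := ht θ
  rw [add_sub_cancel_left, norm_logPolar, ← Real.exp_nat_mul] at h
  push_cast at h
  set y := Real.exp (2 * t) * ‖fderiv ℝ χ (x₀ + logPolar t θ)‖ ^ 2
  have hy : 0 ≤ y := by positivity
  have hs : (Real.sqrt 2 * (F t)⁻¹) ^ 2 = 2 / F t ^ 2 := by
    rw [mul_pow, Real.sq_sqrt (by norm_num), inv_pow, div_eq_mul_inv]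
  have hle : 1 / F t ^ 2 ≤ 2 := by
    rw [div_le_iff₀ (by linarith)]; linarith
  have hk : pohKin (quo F ψ x₀) (quoT F F' ψ x₀) (quoΘ F ψ x₀) t θ ≤ 1 / F t ^ 2
      * (‖fderiv ℝ ψ (x₀ + logPolar t θ) (Complex.I * logPolar t θ)‖ ^ 2
        - ‖ψ (x₀ + logPolar t θ)‖ ^ 2) := by
    have := sq_nonneg ‖quoT F F' ψ x₀ t θ‖
    simp only [pohKin, quo, quoΘ, norm_mul, Complex.norm_real, mul_pow, Real.norm_eq_abs, sq_abs,
      ← mul_pow (Real.sqrt 2), hs]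
    rw [div_eq_mul_inv 2, one_div (F t ^ 2)]
    linear_combination (1 / 2) * this
  calc _ ≤ _ := hk
    _ ≤ 1 / F t ^ 2 * (ε / 2 + C * y) := mul_le_mul_of_nonneg_left h (by positivity)
    _ ≤ 2 * (ε / 2 + C * y) := mul_le_mul_of_nonneg_right hle (by positivity)
    _ = ε + 2 * C * y := by ring

lemma norm_quo_defect_le {F F' F'' : ℝ → ℝ} {a : ℝ} (P : LogProfile F F' F'' a) {ψ : ℂ → ℂ}
    {ρ χ : ℂ → ℝ} {R₀ c φ : ℝ} (H : UnitDegreeAtInfty ψ ρ χ R₀ c φ) (x₀ : ℂ) {η : ℝ} (hη : 0 < η) :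
    ∀ᶠ t in atTop, ∀ θ, |Real.exp t * (‖quo F ψ x₀ t θ‖ ^ 2 - 1)| ≤ η := by
  filter_upwards [eventually_logPolar (H.modulus_defect_le x₀ (show 0 < η / 4 by positivity)) x₀,
    P.eventually_half_le_sq, P.tendsto_exp_mul_defect.eventually
      (gt_mem_nhds (show 0 < η / 4 by positivity))] with t h1 hF h2 θ
  have h := h1 θ
  rw [add_sub_cancel_left, norm_logPolar] at h
  have hE := Real.exp_pos t
  have hle : (F t ^ 2)⁻¹ ≤ 2 := by
    rw [inv_le_comm₀ (by linarith) (by norm_num)]; linarith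
  have e : Real.exp t * (‖quo F ψ x₀ t θ‖ ^ 2 - 1) = (F t ^ 2)⁻¹
      * (Real.exp t * (2 * ‖ψ (x₀ + logPolar t θ)‖ ^ 2 - 1) - Real.exp t * (F t ^ 2 - 1)) := by
    have := (P.pos t).ne'
    rw [quo, norm_mul, Complex.norm_real, mul_pow, Real.norm_eq_abs, sq_abs, mul_pow,
      Real.sq_sqrt (by norm_num)]
    field_simp
    ring
  rw [e, abs_mul, abs_of_nonneg (by positivity : 0 ≤ (F t ^ 2)⁻¹)]
  have h3 : |Real.exp t * (2 * ‖ψ (x₀ + logPolar t θ)‖ ^ 2 - 1) - Real.exp t * (F t ^ 2 - 1)|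
      ≤ η / 4 + η / 4 := by
    refine (abs_sub _ _).trans ?_
    rw [abs_mul, abs_mul, abs_of_pos hE]
    linarith
  calc _ ≤ 2 * (η / 4 + η / 4) := mul_le_mul hle h3 (abs_nonneg _) (by norm_num)
    _ = η := by ring

lemma spinorPot_quo_le {β : ℝ} (hβ : 0 < β) {F F' F'' : ℝ → ℝ} {a : ℝ} (P : LogProfile F F' F'' a)
    {ψp ψm : ℂ → ℂ} {ρp ρm χp χm : ℂ → ℝ} {R₀ c φp φm : ℝ}
    (Hp : UnitDegreeAtInfty ψp ρp χp R₀ c φp) (Hm : UnitDegreeAtInfty ψm ρm χm R₀ c φm)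
    (x₀ : ℂ) {ε : ℝ} (hε : 0 < ε) :
    ∀ᶠ t in atTop, ∀ θ, F t ^ 2 * Real.exp (2 * t)
      * spinorPot β (quo F ψp x₀ t θ) (quo F ψm x₀ t θ) ≤ ε := by
  set η := min 1 (ε / (1 + β))
  have hη : 0 < η := lt_min one_pos (by positivity)
  have hη1 : η ≤ 1 := min_le_left _ _
  have hηε : (1 + β) * η ≤ ε := by
    have := min_le_right 1 (ε / (1 + β))
    rwa [le_div_iff₀ (by positivity), mul_comm] at this
  filter_upwards [norm_quo_defect_le P Hp x₀ hη, norm_quo_defect_le P Hm x₀ hη] with t h1 h2 θ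
  set A := Real.exp t * (‖quo F ψp x₀ t θ‖ ^ 2 - 1) with hA
  set B := Real.exp t * (‖quo F ψm x₀ t θ‖ ^ 2 - 1) with hB
  have hA2 : A ^ 2 ≤ η ^ 2 := sq_le_sq' (abs_le.1 (h1 θ)).1 (abs_le.1 (h1 θ)).2
  have hB2 : B ^ 2 ≤ η ^ 2 := sq_le_sq' (abs_le.1 (h2 θ)).1 (abs_le.1 (h2 θ)).2
  have e : Real.exp (2 * t) * spinorPot β (quo F ψp x₀ t θ) (quo F ψm x₀ t θ)
      = (1 / 8) * (A + B) ^ 2 + (β / 8) * (A - B) ^ 2 := by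
    rw [hA, hB, spinorPot, two_mul, Real.exp_add]; ring
  have hF : F t ^ 2 ≤ 1 := by nlinarith [P.pos t, P.lt_one t]
  rw [mul_assoc, e]
  have hη2 : η ^ 2 ≤ η := by nlinarith
  have b1 : (A + B) ^ 2 ≤ 4 * η ^ 2 := by nlinarith [sq_nonneg (A - B)]
  have b2 : (A - B) ^ 2 ≤ 4 * η ^ 2 := by nlinarith [sq_nonneg (A + B)]
  calc F t ^ 2 * ((1 / 8) * (A + B) ^ 2 + (β / 8) * (A - B) ^ 2)
      ≤ (1 / 8) * (A + B) ^ 2 + (β / 8) * (A - B) ^ 2 :=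
        mul_le_of_le_one_left (by positivity) hF
    _ ≤ (1 / 8) * (4 * η ^ 2) + (β / 8) * (4 * η ^ 2) := by gcongr
    _ ≤ (1 + β) * η := by nlinarith
    _ ≤ ε := hηε

lemma exists_pohFlux_lt {β : ℝ} (hβ : 0 < β) {F F' F'' : ℝ → ℝ} {a : ℝ} (P : LogProfile F F' F'' a)
    {ψp ψm : ℂ → ℂ} (hp : ContDiff ℝ 2 ψp) (hm : ContDiff ℝ 2 ψm) {ρp ρm χp χm : ℂ → ℝ}
    {R₀ c φp φm : ℝ}
    (Hp : UnitDegreeAtInfty ψp ρp χp R₀ c φp) (Hm : UnitDegreeAtInfty ψm ρm χm R₀ c φm)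
    (hint : IntegrableOn (fun x => ‖fderiv ℝ χp x‖ ^ 2 + ‖fderiv ℝ χm x‖ ^ 2) {x : ℂ | R₀ ≤ ‖x‖})
    (x₀ : ℂ) {δ : ℝ} (hδ : 0 < δ) (T : ℝ) : ∃ t > T, pohFlux β F F' ψp ψm x₀ t < δ := by
  have hpi : -π ≤ π := by linarith [Real.pi_pos]
  have hε : 0 < δ / (12 * π) := by positivity
  obtain ⟨Cp, hCp, ep⟩ := pohKin_quo_le P Hp (hp.differentiable (by norm_num)) x₀ hε
  obtain ⟨Cm, hCm, em⟩ := pohKin_quo_le P Hm (hm.differentiable (by norm_num)) x₀ hε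
  have hfar : ∀ᶠ t in atTop, ∀ θ, R₀ < ‖x₀ + logPolar t θ‖ :=
    eventually_logPolar ((eventually_gt_atTop R₀).mono fun r hr x hx => hx ▸ hr) x₀
  obtain ⟨M, hM⟩ := eventually_atTop.1
    (((ep.and em).and (spinorPot_quo_le hβ P Hp Hm x₀ hε)).and hfar)
  set g : ℂ → ℝ := fun x => ‖fderiv ℝ χp x‖ ^ 2 + ‖fderiv ℝ χm x‖ ^ 2 with hg
  have hgc : ContinuousOn g {x : ℂ | R₀ < ‖x‖} :=
    (Hp.continuousOn_fderiv_phase.norm.pow 2).add (Hm.continuousOn_fderiv_phase.norm.pow 2)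
  set C := Cp + Cm
  have hC : 0 ≤ C := add_nonneg hCp hCm
  obtain ⟨t, ht, hlt⟩ := exists_circle_integral_lt hgc hint x₀
    (show 0 < δ / (2 * (C + 1)) by positivity) (max T M)
  refine ⟨t, (le_max_left _ _).trans_lt ht, ?_⟩
  obtain ⟨⟨⟨kp, km⟩, pot⟩, far⟩ := hM t ((le_max_right _ _).trans ht.le)
  obtain ⟨_, _, _, J, -⟩ := quo_jet P hp x₀
  obtain ⟨_, _, _, K, -⟩ := quo_jet P hm x₀
  have hinl : Continuous (fun θ : ℝ => (t, θ)) := continuous_const.prodMk continuous_id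
  have hexp : ContDiff ℝ 1 (fun t => F t ^ 2 * Real.exp (2 * t)) :=
    (P.contDiff.pow 2).mul (by fun_prop)
  have iP := ((contDiff_pohDensity (β := β) hexp J K).continuous.comp hinl).intervalIntegrable
    (μ := volume) (-π) π
  have hgθ : Continuous (fun θ => g (x₀ + logPolar t θ)) :=
    hgc.comp_continuous (continuous_const.add (continuous_logPolar.comp hinl)) far
  have iR : IntervalIntegrable (fun θ => δ / (4 * π)
      + C * (Real.exp (2 * t) * g (x₀ + logPolar t θ))) volume (-π) π :=
    (continuous_const.add (continuous_const.mul (continuous_const.mul hgθ))).intervalIntegrable _ _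
  have hle : pohFlux β F F' ψp ψm x₀ t ≤ ∫ θ in (-π)..π, (δ / (4 * π)
      + C * (Real.exp (2 * t) * g (x₀ + logPolar t θ))) := by
    refine intervalIntegral.integral_mono_on hpi iP iR fun θ _ => ?_
    have h1 := kp θ
    have h2 := km θ
    have h3 := pot θ
    have e3 : δ / (4 * π) = δ / (12 * π) + δ / (12 * π) + δ / (12 * π) := by field_simp; ring
    have n1 : 0 ≤ Cm * (Real.exp (2 * t) * ‖fderiv ℝ χp (x₀ + logPolar t θ)‖ ^ 2) := by positivity
    have n2 : 0 ≤ Cp * (Real.exp (2 * t) * ‖fderiv ℝ χm (x₀ + logPolar t θ)‖ ^ 2) := by positivity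
    simp only [pohDensity, hg, C]
    rw [e3]
    linarith
  refine hle.trans_lt ?_
  have iG : IntervalIntegrable (fun θ => C * (Real.exp (2 * t) * g (x₀ + logPolar t θ))) volume
      (-π) π :=
    (continuous_const.mul (continuous_const.mul hgθ)).intervalIntegrable _ _
  rw [intervalIntegral.integral_add intervalIntegrable_const iG,
    intervalIntegral.integral_const, intervalIntegral.integral_const_mul,
    intervalIntegral.integral_const_mul, smul_eq_mul]
  have e1 : (π - -π) * (δ / (4 * π)) = δ / 2 := by field_simp; ring
  rw [e1]
  have hI : 0 ≤ Real.exp (2 * t) * ∫ θ in (-π)..π, g (x₀ + logPolar t θ) :=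
    mul_nonneg (Real.exp_pos _).le
      (intervalIntegral.integral_nonneg hpi fun θ _ => by simp only [hg]; positivity)
  have h2 : C * (Real.exp (2 * t) * ∫ θ in (-π)..π, g (x₀ + logPolar t θ)) < δ / 2 := by
    rw [lt_div_iff₀ (by positivity)] at hlt
    nlinarith
  linarith

/-- The quotients by the profile do not depend on the radius. -/
lemma quoT_eq_zero {β : ℝ} (hβ : 0 < β) {F F' F'' : ℝ → ℝ} {a : ℝ} (P : LogProfile F F' F'' a)
    {ψp ψm : ℂ → ℂ} (hsol : EntireSolution β ψp ψm) {x₀ : ℂ} (hzp : ψp x₀ = 0) (hzm : ψm x₀ = 0)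
    {ρp ρm χp χm : ℂ → ℝ} {R₀ c φp φm : ℝ}
    (Hp : UnitDegreeAtInfty ψp ρp χp R₀ c φp) (Hm : UnitDegreeAtInfty ψm ρm χm R₀ c φm)
    (hint : IntegrableOn (fun x => ‖fderiv ℝ χp x‖ ^ 2 + ‖fderiv ℝ χm x‖ ^ 2) {x : ℂ | R₀ ≤ ‖x‖})
    {t θ : ℝ} (hθ : θ ∈ Icc (-π) π) :
    quoT F F' ψp x₀ t θ = 0 ∧ quoT F F' ψm x₀ t θ = 0 := by
  have hflux : ∀ t, pohFlux β F F' ψp ψm x₀ t = 0 := fun t => by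
    refine le_antisymm (le_of_forall_pos_le_add fun δ hδ => ?_) (pohFlux_nonneg hβ P hsol hzp hzm t)
    obtain ⟨s, hs, hlt⟩ := exists_pohFlux_lt hβ P hsol.1 hsol.2.1 Hp Hm hint x₀ hδ t
    have := pohFlux_mono hβ P hsol x₀ hs.le
    linarith
  have h0 : pohDissipation β F F' ψp ψm x₀ t θ = 0 :=
    eq_zero_of_integral2_eq_zero (continuous_pohDissipation P hsol.1 hsol.2.1 x₀)
      (pohDissipation_nonneg hβ P ψp ψm x₀)
      (fun t₁ t₂ => by rw [pohFlux_sub P hsol, hflux, hflux, sub_zero]) hθ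
  have hF := P.pos t
  have hF' := P.deriv_pos t
  have hpot := spinorPot_nonneg hβ (quo F ψp x₀ t θ) (quo F ψm x₀ t θ)
  have h1 : 0 ≤ (2 * F t * F' t * Real.exp (2 * t) + F t ^ 2 * (2 * Real.exp (2 * t)))
      * spinorPot β (quo F ψp x₀ t θ) (quo F ψm x₀ t θ) := by positivity
  have hκ : 0 < 2 * F' t / F t := by positivity
  unfold pohDissipation at h0
  have h2 : ‖quoT F F' ψp x₀ t θ‖ ^ 2 + ‖quoT F F' ψm x₀ t θ‖ ^ 2 ≤ 0 :=
    nonpos_of_mul_nonpos_right (by linarith) hκ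
  have n1 := sq_nonneg ‖quoT F F' ψp x₀ t θ‖
  have n2 := sq_nonneg ‖quoT F F' ψm x₀ t θ‖
  exact ⟨norm_eq_zero.1 (pow_eq_zero_iff (two_ne_zero) |>.1 (by linarith)),
    norm_eq_zero.1 (pow_eq_zero_iff (two_ne_zero) |>.1 (by linarith))⟩

/-- A radially constant quotient is determined by its limit at infinity. -/
lemma eq_of_quoT_eq_zero {F F' F'' : ℝ → ℝ} {a : ℝ} (P : LogProfile F F' F'' a)
    {ψ : ℂ → ℂ} (hψ : ContDiff ℝ 2 ψ) {x₀ : ℂ} {ρ χ : ℂ → ℝ} {R₀ c φ : ℝ}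
    (H : UnitDegreeAtInfty ψ ρ χ R₀ c φ) {θ : ℝ} (h : ∀ t, quoT F F' ψ x₀ t θ = 0) (t : ℝ) :
    ψ (x₀ + logPolar t θ) = (Real.sqrt 2 : ℂ)⁻¹ * ((F t : ℂ) * logPolar 0 θ)
      * Complex.exp (Complex.I * (φ : ℂ)) := by
  obtain ⟨_, _, _, J, -⟩ := quo_jet P hψ x₀
  have hconst : ∀ s, quo F ψ x₀ s θ = quo F ψ x₀ t θ := fun s =>
    is_const_of_deriv_eq_zero (fun s => (J.deriv_t s θ).differentiableAt)
      (fun s => by rw [(J.deriv_t s θ).deriv, h]) s t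
  have hs2 : (Real.sqrt 2 : ℂ) ≠ 0 := by exact_mod_cast (by positivity : (0 : ℝ) < Real.sqrt 2).ne'
  have hc : Tendsto (fun t => ((Real.sqrt 2 * (F t)⁻¹ : ℝ) : ℂ)) atTop
      (𝓝 ((Real.sqrt 2 * 1⁻¹ : ℝ) : ℂ)) :=
    (Complex.continuous_ofReal.tendsto _).comp
      ((P.tendsto_atTop.inv₀ one_ne_zero).const_mul (Real.sqrt 2))
  have hlim := (hc.mul (H.tendsto_comp_logPolar x₀ θ)).congr (fun s => hconst s)
  have hq := tendsto_nhds_unique tendsto_const_nhds hlim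
  have hF : (F t : ℂ) ≠ 0 := by exact_mod_cast (P.pos t).ne'
  unfold quo at hq
  push_cast at hq
  field_simp at hq ⊢
  linear_combination hq

lemma HasDegreeAtInfty.exists_unitDegreeAtInfty {ψp ψm : ℂ → ℂ}
    (h : HasDegreeAtInfty 1 1 ψp ψm) :
    ∃ (R₀ c φp φm : ℝ) (ρp ρm χp χm : ℂ → ℝ),
      UnitDegreeAtInfty ψp ρp χp R₀ c φp ∧ UnitDegreeAtInfty ψm ρm χm R₀ c φm ∧
      IntegrableOn (fun x => ‖fderiv ℝ χp x‖ ^ 2 + ‖fderiv ℝ χm x‖ ^ 2) {x : ℂ | R₀ ≤ ‖x‖} := by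
  obtain ⟨R₀, hR, c, -, φp, φm, ρp, ρm, χp, χm, h1, h2, h3, h4, hpos, heq, hmod, hfd, hint, hlim⟩ := h
  refine ⟨R₀, c, φp, φm, ρp, ρm, χp, χm,
    ⟨hR, h1, h3, fun x hx => (hpos x hx).1, fun x hx => by simpa using (heq x hx).1,
      fun x hx => (hmod x hx).1, fun x hx => (hfd x hx).1, fun δ hδ =>
        (hlim δ hδ).imp fun M hM x hx => (hM x hx).1⟩,
    ⟨hR, h2, h4, fun x hx => (hpos x hx).2, fun x hx => by simpa using (heq x hx).2,
      fun x hx => (hmod x hx).2, fun x hx => (hfd x hx).2, fun δ hδ =>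
        (hlim δ hδ).imp fun M hM x hx => (hM x hx).2⟩, ?_⟩
  have hms : MeasurableSet {x : ℂ | R₀ ≤ ‖x‖} :=
    (isClosed_le continuous_const continuous_norm).measurableSet
  refine Integrable.mono' hint (Measurable.aestronglyMeasurable ?_) (Eventually.of_forall fun x => ?_)
  · exact ((measurable_fderiv ℝ χp).norm.pow_const 2).add ((measurable_fderiv ℝ χm).norm.pow_const 2)
  · rw [Real.norm_of_nonneg (by positivity)]
    have := sq_nonneg ‖fderiv ℝ ρp x‖
    have := sq_nonneg ‖fderiv ℝ ρm x‖
    linarith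

end

/-- Uniqueness of entire solutions with degree pair `[1,1]` whose components share a
common zero: they coincide, up to constant phases, with the translated equivariant
degree-one Ginzburg–Landau solution in each component. -/
theorem statement13 (β : ℝ) (hβ : 0 < β) (ψp ψm : ℂ → ℂ)
    (hsol : EntireSolution β ψp ψm) (hdeg : HasDegreeAtInfty 1 1 ψp ψm)
    (x₀ : ℂ) (hzp : ψp x₀ = 0) (hzm : ψm x₀ = 0)
    (f : ℝ → ℝ) (hf0 : f 0 = 0) (hfpos : ∀ r > (0 : ℝ), 0 < f r)
    (hasym : ∃ C > (0 : ℝ), ∃ r₁ : ℝ, ∀ r : ℝ, r₁ ≤ r →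
      |f r - 1| ≤ C / r ^ 2 ∧ |deriv f r| ≤ C / r ^ 3)
    (u : ℂ → ℂ)
    (hu : ∀ x : ℂ, u x = (f ‖x‖ : ℂ) * Complex.exp (Complex.I * (Complex.arg x : ℂ)))
    (huC2 : ContDiff ℝ 2 u)
    (huSol : ∀ x : ℂ, -lap u x = ((1 - ‖u x‖ ^ 2 : ℝ) : ℂ) * u x) :
    ∃ φp φm : ℝ, ∀ x : ℂ,
      ψp x = (Real.sqrt 2 : ℂ)⁻¹ * u (x - x₀) * Complex.exp (Complex.I * (φp : ℝ)) ∧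
      ψm x = (Real.sqrt 2 : ℂ)⁻¹ * u (x - x₀) * Complex.exp (Complex.I * (φm : ℝ)) := by
  obtain ⟨C, -, r₁, h⟩ := hasym
  obtain ⟨F', F'', a, P⟩ := exists_logProfile hf0 hfpos (fun r hr => (h r hr).1) hu huC2 huSol
  obtain ⟨R₀, c, φp, φm, ρp, ρm, χp, χm, Hp, Hm, hint⟩ := hdeg.exists_unitDegreeAtInfty
  refine ⟨φp, φm, fun x => ?_⟩
  rcases eq_or_ne x x₀ with rfl | hx
  · simp [hzp, hzm, hu, hf0]
  have hz : x - x₀ ≠ 0 := sub_ne_zero.2 hx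
  have hn : 0 < ‖x - x₀‖ := norm_pos_iff.2 hz
  have hθ : Complex.arg (x - x₀) ∈ Icc (-Real.pi) Real.pi :=
    Ioc_subset_Icc_self (Complex.arg_mem_Ioc _)
  have hq := fun t => quoT_eq_zero hβ P hsol hzp hzm Hp Hm hint (t := t) hθ
  have hpt : x₀ + logPolar (Real.log ‖x - x₀‖) (Complex.arg (x - x₀)) = x := by
    rw [logPolar_eq, Real.exp_log hn, logPolar, Complex.ofReal_zero, zero_add,
      Complex.norm_mul_exp_arg_mul_I, add_sub_cancel]
  have huz : u (x - x₀) = (f (Real.exp (Real.log ‖x - x₀‖)) : ℂ)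
      * logPolar 0 (Complex.arg (x - x₀)) := by
    rw [hu, Real.exp_log hn, logPolar, Complex.ofReal_zero, zero_add, mul_comm Complex.I]
  have ep := eq_of_quoT_eq_zero P hsol.1 Hp (fun t => (hq t).1) (Real.log ‖x - x₀‖)
  have em := eq_of_quoT_eq_zero P hsol.2.1 Hm (fun t => (hq t).2) (Real.log ‖x - x₀‖)
  rw [hpt, ← huz] at ep em
  exact ⟨ep, em⟩
end
end

section
/- For every β > 0 there exists λ* > 0 such that for all 0 < λ < λ*, any two solutions of the Dirichlet problem (DP) on the unit disk (with parameters λ, β) are equal. -/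
open MeasureTheory Metric Set Filter Complex

noncomputable section

/-- `Ψ = (ψ₊,ψ₋)` is a solution of the Dirichlet problem (DP) on the unit disk:
continuous on the closed disk, `C²` on the open disk, solving the two-component
Ginzburg–Landau system with parameters `λ, β`, with symmetric degree-one boundary data. -/
def DPSolution (lam β : ℝ) (ψp ψm : ℂ → ℂ) : Prop :=
  ContinuousOn ψp (closedBall 0 1) ∧ ContinuousOn ψm (closedBall 0 1) ∧
  ContDiffOn ℝ 2 ψp (ball 0 1) ∧ ContDiffOn ℝ 2 ψm (ball 0 1) ∧
  (∀ x ∈ ball (0 : ℂ) 1,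
    -lap ψp x =
      (lam : ℂ) * ((1 - (‖ψp x‖ ^ 2 + ‖ψm x‖ ^ 2) : ℝ) : ℂ) * ψp x
        + (lam : ℂ) * (β : ℂ) * ((‖ψm x‖ ^ 2 - ‖ψp x‖ ^ 2 : ℝ) : ℂ) * ψp x ∧
    -lap ψm x =
      (lam : ℂ) * ((1 - (‖ψp x‖ ^ 2 + ‖ψm x‖ ^ 2) : ℝ) : ℂ) * ψm x
        - (lam : ℂ) * (β : ℂ) * ((‖ψm x‖ ^ 2 - ‖ψp x‖ ^ 2 : ℝ) : ℂ) * ψm x) ∧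
  (∀ x : ℂ, ‖x‖ = 1 →
    ψp x = (Real.sqrt 2 : ℂ)⁻¹ * x ∧ ψm x = (Real.sqrt 2 : ℂ)⁻¹ * x)

/-- Second-order necessary condition for a local maximum of a real function. -/
lemma second_deriv_nonpos_of_isLocalMax {h h' : ℝ → ℝ} {a k : ℝ}
    (hd : ∀ᶠ t in nhds a, HasDerivAt h (h' t) t) (hd' : HasDerivAt h' k a)
    (hmax : IsLocalMax h a) : k ≤ 0 := by
  by_contra! hk
  have e1 : deriv h =ᶠ[nhds a] h' := hd.mono fun t ht => ht.deriv
  have e2 : deriv (deriv h) a = k := by rw [e1.deriv_eq, hd'.deriv]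
  have hmin : IsLocalMin h a := isLocalMin_of_deriv_deriv_pos (by rw [e2]; exact hk)
    hmax.deriv_eq_zero hd.self_of_nhds.continuousAt
  have hconst : h =ᶠ[nhds a] fun _ => h a := by
    filter_upwards [hmax, hmin] with t h1 h2 using le_antisymm h1 h2
  have e3 : deriv h =ᶠ[nhds a] fun _ => 0 := by
    filter_upwards [hconst.eventuallyEq_nhds] with t ht
    rw [ht.deriv_eq, deriv_const]
  have e4 : deriv (deriv h) a = 0 := by rw [e3.deriv_eq, deriv_const]
  linarith

lemma differentiableAt_fderiv_apply {f : ℂ → ℂ} {s : Set ℂ} (hs : IsOpen s)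
    (hf : ContDiffOn ℝ 2 f s) {x : ℂ} (hx : x ∈ s) (v : ℂ) :
    DifferentiableAt ℝ (fun y => fderiv ℝ f y v) x := by
  have h2 : ContDiffAt ℝ 2 f x := hf.contDiffAt (hs.mem_nhds hx)
  have h1 : ContDiffAt ℝ 1 (fderiv ℝ f) x := h2.fderiv_right (by norm_num)
  exact (h1.differentiableAt (by norm_num)).clm_apply (differentiableAt_const v)

lemma hasDerivAt_add_mul (x v : ℂ) (t : ℝ) :
    HasDerivAt (fun t : ℝ => x + t * v) v t := by
  simpa using ((Complex.ofRealCLM.hasDerivAt (x := t)).mul_const v).const_add x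

lemma eventually_add_mul_mem {s : Set ℂ} (hs : IsOpen s) {x : ℂ} (hx : x ∈ s) (v : ℂ) :
    ∀ᶠ t : ℝ in nhds 0, x + t * v ∈ s := by
  have h := (hasDerivAt_add_mul x v 0).continuousAt
  apply h.eventually_mem
  simpa using hs.mem_nhds hx

lemma hasDerivAt_along {f : ℂ → ℂ} {s : Set ℂ} (hs : IsOpen s)
    (hf : ContDiffOn ℝ 2 f s) (x v : ℂ) {t : ℝ} (hx : x + t * v ∈ s) :
    HasDerivAt (fun t : ℝ => f (x + t * v)) (fderiv ℝ f (x + t * v) v) t := by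
  have h1 : DifferentiableAt ℝ f (x + t * v) :=
    (hf.contDiffAt (hs.mem_nhds hx)).differentiableAt (by norm_num)
  exact h1.hasFDerivAt.comp_hasDerivAt t (hasDerivAt_add_mul x v t)

lemma hasDerivAt_fderiv_along {f : ℂ → ℂ} {s : Set ℂ} (hs : IsOpen s)
    (hf : ContDiffOn ℝ 2 f s) {x : ℂ} (hx : x ∈ s) (v : ℂ) :
    HasDerivAt (fun t : ℝ => fderiv ℝ f (x + t * v) v)
      (fderiv ℝ (fun y => fderiv ℝ f y v) x v) 0 := by
  have h1 : HasFDerivAt (fun y => fderiv ℝ f y v) (fderiv ℝ (fun y => fderiv ℝ f y v) x)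
      (x + (0 : ℝ) * v) := by
    simpa using (differentiableAt_fderiv_apply hs hf hx v).hasFDerivAt
  exact h1.comp_hasDerivAt (0 : ℝ) (hasDerivAt_add_mul x v 0)

/-- Directional second-order condition at a local maximum of `‖f‖² + ‖g‖² + c ‖·‖²`. -/
lemma inner_second_deriv_le_of_isLocalMax {f g : ℂ → ℂ} {s : Set ℂ} (hs : IsOpen s)
    (hf : ContDiffOn ℝ 2 f s) (hg : ContDiffOn ℝ 2 g s) {x : ℂ} (hx : x ∈ s) {c : ℝ}
    (hmax : IsLocalMax (fun y => ‖f y‖ ^ 2 + ‖g y‖ ^ 2 + c * ‖y‖ ^ 2) x) (v : ℂ) :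
    inner ℝ (f x) (fderiv ℝ (fun y => fderiv ℝ f y v) x v)
      + inner ℝ (g x) (fderiv ℝ (fun y => fderiv ℝ g y v) x v) + c * ‖v‖ ^ 2 ≤ 0 := by
  have hd : ∀ᶠ t : ℝ in nhds 0, HasDerivAt
      (fun t : ℝ => ‖f (x + t * v)‖ ^ 2 + ‖g (x + t * v)‖ ^ 2 + c * ‖x + t * v‖ ^ 2)
      (2 * inner ℝ (f (x + t * v)) (fderiv ℝ f (x + t * v) v)
        + 2 * inner ℝ (g (x + t * v)) (fderiv ℝ g (x + t * v) v)
        + c * (2 * inner ℝ (x + t * v) v)) t := by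
    filter_upwards [eventually_add_mul_mem hs hx v] with t ht
    exact ((hasDerivAt_along hs hf x v ht).norm_sq.add
      (hasDerivAt_along hs hg x v ht).norm_sq).add
        ((hasDerivAt_add_mul x v t).norm_sq.const_mul c)
  have hx0 : x + (0 : ℝ) * v ∈ s := by simpa using hx
  have hd' := ((((hasDerivAt_along hs hf x v hx0).inner ℝ
      (hasDerivAt_fderiv_along hs hf hx v)).const_mul 2).add
    (((hasDerivAt_along hs hg x v hx0).inner ℝ
      (hasDerivAt_fderiv_along hs hg hx v)).const_mul 2)).add
    ((((hasDerivAt_add_mul x v 0).inner ℝ (hasDerivAt_const (0 : ℝ) v)).const_mul 2).const_mul c)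
  have hm : IsLocalMax
      (fun t : ℝ => ‖f (x + t * v)‖ ^ 2 + ‖g (x + t * v)‖ ^ 2 + c * ‖x + t * v‖ ^ 2) 0 := by
    have ht : Tendsto (fun t : ℝ => x + t * v) (nhds 0) (nhds x) := by
      simpa using (hasDerivAt_add_mul x v 0).continuousAt.tendsto
    have := ht.eventually hmax
    simpa [IsLocalMax, IsMaxFilter] using this
  have key := second_deriv_nonpos_of_isLocalMax hd hd' hm
  simp only [Complex.ofReal_zero, zero_mul, add_zero, inner_zero_right, zero_add,
    real_inner_self_eq_norm_sq] at key
  nlinarith [sq_nonneg ‖fderiv ℝ f x v‖, sq_nonneg ‖fderiv ℝ g x v‖]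

lemma inner_lap_le_of_isLocalMax {f g : ℂ → ℂ} {s : Set ℂ} (hs : IsOpen s)
    (hf : ContDiffOn ℝ 2 f s) (hg : ContDiffOn ℝ 2 g s) {x : ℂ} (hx : x ∈ s) {c : ℝ}
    (hmax : IsLocalMax (fun y => ‖f y‖ ^ 2 + ‖g y‖ ^ 2 + c * ‖y‖ ^ 2) x) :
    inner ℝ (f x) (lap f x) + inner ℝ (g x) (lap g x) + 2 * c ≤ 0 := by
  have h1 := inner_second_deriv_le_of_isLocalMax hs hf hg hx hmax 1
  have h2 := inner_second_deriv_le_of_isLocalMax hs hf hg hx hmax Complex.I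
  simp only [norm_one, Complex.norm_I, one_pow, mul_one] at h1 h2
  simp only [lap, inner_add_right]
  linarith

lemma lap_sub {f g : ℂ → ℂ} {s : Set ℂ} (hs : IsOpen s)
    (hf : ContDiffOn ℝ 2 f s) (hg : ContDiffOn ℝ 2 g s) {x : ℂ} (hx : x ∈ s) :
    lap (fun y => f y - g y) x = lap f x - lap g x := by
  have key : ∀ v : ℂ, fderiv ℝ (fun y => fderiv ℝ (fun y => f y - g y) y v) x v
      = fderiv ℝ (fun y => fderiv ℝ f y v) x v - fderiv ℝ (fun y => fderiv ℝ g y v) x v := by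
    intro v
    have e : (fun y => fderiv ℝ (fun y => f y - g y) y v) =ᶠ[nhds x]
        fun y => fderiv ℝ f y v - fderiv ℝ g y v := by
      filter_upwards [hs.mem_nhds hx] with y hy
      rw [fderiv_fun_sub ((hf.contDiffAt (hs.mem_nhds hy)).differentiableAt (by norm_num))
        ((hg.contDiffAt (hs.mem_nhds hy)).differentiableAt (by norm_num))]
      rfl
    rw [e.fderiv_eq, fderiv_fun_sub (differentiableAt_fderiv_apply hs hf hx v)
      (differentiableAt_fderiv_apply hs hg hx v)]
    rfl
  simp only [lap, key]
  ring

lemma norm_sq_inv_sqrt_two_mul {x : ℂ} (hx : ‖x‖ = 1) :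
    ‖(Real.sqrt 2 : ℂ)⁻¹ * x‖ ^ 2 = 1 / 2 := by
  rw [norm_mul, hx, norm_inv, Complex.norm_real, mul_one, inv_pow, Real.norm_eq_abs, sq_abs,
    Real.sq_sqrt (by norm_num)]
  norm_num

/-- The equations of (DP), with real scalar coefficients. -/
lemma DPSolution.lap_eq {lam β : ℝ} {ψp ψm : ℂ → ℂ} (h : DPSolution lam β ψp ψm) {x : ℂ}
    (hx : x ∈ ball (0 : ℂ) 1) :
    lap ψp x = -(lam * (1 - (‖ψp x‖ ^ 2 + ‖ψm x‖ ^ 2)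
        + β * (‖ψm x‖ ^ 2 - ‖ψp x‖ ^ 2))) • ψp x ∧
    lap ψm x = -(lam * (1 - (‖ψp x‖ ^ 2 + ‖ψm x‖ ^ 2)
        - β * (‖ψm x‖ ^ 2 - ‖ψp x‖ ^ 2))) • ψm x := by
  obtain ⟨-, -, -, -, heq, -⟩ := h
  obtain ⟨h1, h2⟩ := heq x hx
  constructor
  · rw [← neg_neg (lap ψp x), h1, Complex.real_smul]
    push_cast
    ring
  · rw [← neg_neg (lap ψm x), h2, Complex.real_smul]
    push_cast
    ring

/-- Solutions of (DP) take values in the closed unit ball of `ℂ²`. -/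
lemma DPSolution.norm_sq_le_one {lam β : ℝ} (hlam : 0 < lam) (hβ : 0 < β) {ψp ψm : ℂ → ℂ}
    (h : DPSolution lam β ψp ψm) {x : ℂ} (hx : x ∈ closedBall (0 : ℂ) 1) :
    ‖ψp x‖ ^ 2 + ‖ψm x‖ ^ 2 ≤ 1 := by
  obtain ⟨hcp, hcm, hp, hm, -, hbd⟩ := id h
  obtain ⟨x₀, hx₀, hmax⟩ := (isCompact_closedBall (0 : ℂ) 1).exists_isMaxOn ⟨x, hx⟩
    ((hcp.norm.pow 2).add (hcm.norm.pow 2))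
  refine (hmax hx).trans ?_
  change ‖ψp x₀‖ ^ 2 + ‖ψm x₀‖ ^ 2 ≤ 1
  rcases (mem_closedBall_zero_iff.1 hx₀).lt_or_eq with hlt | heq
  · have hb : x₀ ∈ ball (0 : ℂ) 1 := mem_ball_zero_iff.2 hlt
    have hloc : IsLocalMax (fun y => ‖ψp y‖ ^ 2 + ‖ψm y‖ ^ 2) x₀ := hmax.isLocalMax
      (mem_of_superset (isOpen_ball.mem_nhds hb) ball_subset_closedBall)
    have key := inner_lap_le_of_isLocalMax (c := 0) isOpen_ball hp hm hb (by simpa using hloc)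
    obtain ⟨e1, e2⟩ := h.lap_eq hb
    rw [e1, e2, real_inner_smul_right, real_inner_smul_right, real_inner_self_eq_norm_sq,
      real_inner_self_eq_norm_sq] at key
    set a := ‖ψp x₀‖ ^ 2
    set b := ‖ψm x₀‖ ^ 2
    by_contra! hab
    have h1 : 0 < lam * ((a + b - 1) * (a + b) + β * (a - b) ^ 2) := by
      have : 0 < (a + b - 1) * (a + b) := mul_pos (by linarith) (by linarith)
      have : 0 ≤ β * (a - b) ^ 2 := by positivity
      exact mul_pos hlam (by linarith)
    nlinarith
  · obtain ⟨e1, e2⟩ := hbd x₀ heq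
    rw [e1, e2, norm_sq_inv_sqrt_two_mul heq]
    norm_num

lemma abs_norm_sq_sub_norm_sq_le {p q : ℂ} (hp : ‖p‖ ≤ 1) (hq : ‖q‖ ≤ 1) :
    |‖p‖ ^ 2 - ‖q‖ ^ 2| ≤ 2 * ‖p - q‖ := by
  have h1 : ‖p‖ ^ 2 - ‖q‖ ^ 2 = (‖p‖ + ‖q‖) * (‖p‖ - ‖q‖) := by ring
  rw [h1, abs_mul, abs_of_nonneg (by positivity)]
  exact mul_le_mul (by linarith) (abs_norm_sub_norm_le p q) (abs_nonneg _) (by norm_num)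

lemma inner_sub_smul_sub_smul_le {p p' : ℂ} {s s' S T : ℝ} (hs : |s| ≤ S) (hT : |s - s'| ≤ T)
    (hp' : ‖p'‖ ≤ 1) :
    inner ℝ (p - p') (s • p - s' • p') ≤ S * ‖p - p'‖ ^ 2 + T * ‖p - p'‖ := by
  have e : s • p - s' • p' = s • (p - p') + (s - s') • p' := by
    rw [smul_sub, sub_smul]
    abel
  rw [e, inner_add_right, real_inner_smul_right, real_inner_smul_right,
    real_inner_self_eq_norm_sq]
  have h1 : s * ‖p - p'‖ ^ 2 ≤ S * ‖p - p'‖ ^ 2 :=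
    mul_le_mul_of_nonneg_right ((le_abs_self s).trans hs) (by positivity)
  have h2 : (s - s') * inner ℝ (p - p') p' ≤ T * ‖p - p'‖ := by
    refine (le_abs_self _).trans ?_
    rw [abs_mul]
    refine mul_le_mul hT ((abs_real_inner_le_norm _ _).trans ?_) (abs_nonneg _)
      ((abs_nonneg _).trans hT)
    exact mul_le_of_le_one_right (norm_nonneg _) hp'
  linarith

/-- One-sided Lipschitz estimate for the nonlinearity on the unit ball of `ℂ²`. -/
lemma inner_nonlinearity_sub_le {β : ℝ} (hβ : 0 < β) {p m p' m' : ℂ}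
    (h : ‖p‖ ^ 2 + ‖m‖ ^ 2 ≤ 1) (h' : ‖p'‖ ^ 2 + ‖m'‖ ^ 2 ≤ 1) :
    inner ℝ (p - p') ((1 - (‖p‖ ^ 2 + ‖m‖ ^ 2) + β * (‖m‖ ^ 2 - ‖p‖ ^ 2)) • p
        - (1 - (‖p'‖ ^ 2 + ‖m'‖ ^ 2) + β * (‖m'‖ ^ 2 - ‖p'‖ ^ 2)) • p')
      + inner ℝ (m - m') ((1 - (‖p‖ ^ 2 + ‖m‖ ^ 2) - β * (‖m‖ ^ 2 - ‖p‖ ^ 2)) • m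
        - (1 - (‖p'‖ ^ 2 + ‖m'‖ ^ 2) - β * (‖m'‖ ^ 2 - ‖p'‖ ^ 2)) • m')
      ≤ 5 * (1 + β) * (‖p - p'‖ ^ 2 + ‖m - m'‖ ^ 2) := by
  have hp : ‖p‖ ≤ 1 := by nlinarith [sq_nonneg ‖m‖]
  have hm : ‖m‖ ≤ 1 := by nlinarith [sq_nonneg ‖p‖]
  have hp' : ‖p'‖ ≤ 1 := by nlinarith [sq_nonneg ‖m'‖]
  have hm' : ‖m'‖ ≤ 1 := by nlinarith [sq_nonneg ‖p'‖]
  have ha := abs_le.1 (abs_norm_sq_sub_norm_sq_le hp hp')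
  have hb := abs_le.1 (abs_norm_sq_sub_norm_sq_le hm hm')
  have hap : 0 ≤ ‖p‖ ^ 2 := sq_nonneg _
  have hbp : 0 ≤ ‖m‖ ^ 2 := sq_nonneg _
  generalize ‖p‖ ^ 2 = a at *
  generalize ‖m‖ ^ 2 = b at *
  generalize ‖p'‖ ^ 2 = a' at *
  generalize ‖m'‖ ^ 2 = b' at *
  have k1 : |β * (b - a)| ≤ β := by
    rw [abs_mul, abs_of_pos hβ]
    exact mul_le_of_le_one_right hβ.le (abs_le.2 ⟨by linarith, by linarith⟩)
  have k2 : |β * ((b - b') - (a - a'))| ≤ β * (2 * (‖p - p'‖ + ‖m - m'‖)) := by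
    rw [abs_mul, abs_of_pos hβ]
    exact mul_le_mul_of_nonneg_left (abs_le.2 ⟨by linarith, by linarith⟩) hβ.le
  rw [abs_le] at k1 k2
  have i1 := inner_sub_smul_sub_smul_le (p := p) (p' := p') (S := 1 + β)
    (T := (1 + β) * (2 * (‖p - p'‖ + ‖m - m'‖)))
    (s := 1 - (a + b) + β * (b - a)) (s' := 1 - (a' + b') + β * (b' - a'))
    (abs_le.2 ⟨by linarith, by linarith⟩) (abs_le.2 ⟨by linarith, by linarith⟩) hp'
  have i2 := inner_sub_smul_sub_smul_le (p := m) (p' := m') (S := 1 + β)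
    (T := (1 + β) * (2 * (‖p - p'‖ + ‖m - m'‖)))
    (s := 1 - (a + b) - β * (b - a)) (s' := 1 - (a' + b') - β * (b' - a'))
    (abs_le.2 ⟨by linarith, by linarith⟩) (abs_le.2 ⟨by linarith, by linarith⟩) hm'
  have i3 : 0 ≤ (1 + β) * (‖p - p'‖ - ‖m - m'‖) ^ 2 := by positivity
  linarith

/-- For every `β > 0` there is `λ* > 0` such that for `0 < λ < λ*` the Dirichlet problem
(DP) on the unit disk has at most one solution (any two solutions agree on the closed
unit disk). -/
theorem statement14 (β : ℝ) (hβ : 0 < β) :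
    ∃ lamStar > (0 : ℝ), ∀ lam : ℝ, 0 < lam → lam < lamStar →
      ∀ ψp ψm ψp' ψm' : ℂ → ℂ,
        DPSolution lam β ψp ψm → DPSolution lam β ψp' ψm' →
        ∀ x ∈ closedBall (0 : ℂ) 1, ψp x = ψp' x ∧ ψm x = ψm' x := by
  refine ⟨1 / (5 * (1 + β)), by positivity, ?_⟩
  intro lam hlam hlt ψp ψm ψp' ψm' h h' x hx
  have hC : lam * (5 * (1 + β)) < 1 := (lt_div_iff₀ (by positivity)).1 hlt
  obtain ⟨hcp, hcm, hp, hm, -, hbd⟩ := id h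
  obtain ⟨hcp', hcm', hp', hm', -, hbd'⟩ := id h'
  have hg : ∀ y ∈ closedBall (0 : ℂ) 1, 1 ≤ 2 - ‖y‖ ^ 2 := by
    intro y hy
    have := mem_closedBall_zero_iff.1 hy
    nlinarith [norm_nonneg y]
  have hcont : ContinuousOn
      (fun y => (‖ψp y - ψp' y‖ ^ 2 + ‖ψm y - ψm' y‖ ^ 2) / (2 - ‖y‖ ^ 2))
      (closedBall (0 : ℂ) 1) :=
    (((hcp.sub hcp').norm.pow 2).add ((hcm.sub hcm').norm.pow 2)).div
      (by fun_prop) fun y hy => by linarith [hg y hy]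
  obtain ⟨x₀, hx₀, hmax⟩ := (isCompact_closedBall (0 : ℂ) 1).exists_isMaxOn ⟨x, hx⟩ hcont
  set M := (‖ψp x₀ - ψp' x₀‖ ^ 2 + ‖ψm x₀ - ψm' x₀‖ ^ 2) / (2 - ‖x₀‖ ^ 2) with hM
  have hle : ∀ y ∈ closedBall (0 : ℂ) 1,
      ‖ψp y - ψp' y‖ ^ 2 + ‖ψm y - ψm' y‖ ^ 2 ≤ M * (2 - ‖y‖ ^ 2) := by
    intro y hy
    exact (div_le_iff₀ (by linarith [hg y hy])).1 (hmax hy)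
  have heq₀ : ‖ψp x₀ - ψp' x₀‖ ^ 2 + ‖ψm x₀ - ψm' x₀‖ ^ 2 = M * (2 - ‖x₀‖ ^ 2) :=
    (div_eq_iff (by linarith [hg x₀ hx₀])).1 hM.symm
  have hM0 : M ≤ 0 := by
    rcases (mem_closedBall_zero_iff.1 hx₀).lt_or_eq with hlt₀ | hone
    · by_contra! hMpos
      have hb : x₀ ∈ ball (0 : ℂ) 1 := mem_ball_zero_iff.2 hlt₀
      have hloc : IsLocalMax
          (fun y => ‖ψp y - ψp' y‖ ^ 2 + ‖ψm y - ψm' y‖ ^ 2 + M * ‖y‖ ^ 2) x₀ := by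
        filter_upwards [isOpen_ball.mem_nhds hb] with y hy
        linarith [hle y (ball_subset_closedBall hy)]
      have key := inner_lap_le_of_isLocalMax isOpen_ball (hp.sub hp') (hm.sub hm') hb hloc
      have l1 := lap_sub isOpen_ball hp hp' hb
      have l2 := lap_sub isOpen_ball hm hm' hb
      obtain ⟨e1, e2⟩ := h.lap_eq hb
      obtain ⟨e1', e2'⟩ := h'.lap_eq hb
      have hN := inner_nonlinearity_sub_le hβ (h.norm_sq_le_one hlam hβ hx₀)
        (h'.norm_sq_le_one hlam hβ hx₀)
      change inner ℝ (ψp x₀ - ψp' x₀) (lap (fun y => ψp y - ψp' y) x₀)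
        + inner ℝ (ψm x₀ - ψm' x₀) (lap (fun y => ψm y - ψm' y) x₀) + 2 * M ≤ 0 at key
      rw [l1, l2, e1, e2, e1', e2'] at key
      simp only [neg_smul, mul_smul, ← smul_sub, sub_neg_eq_add, neg_add_eq_sub,
        inner_sub_right, real_inner_smul_right] at key hN
      have hN' := mul_le_mul_of_nonneg_left hN hlam.le
      have hup : lam * (5 * (1 + β) * (‖ψp x₀ - ψp' x₀‖ ^ 2 + ‖ψm x₀ - ψm' x₀‖ ^ 2))
          < 2 * M := by
        have h2 : ‖ψp x₀ - ψp' x₀‖ ^ 2 + ‖ψm x₀ - ψm' x₀‖ ^ 2 ≤ 2 * M := by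
          rw [heq₀]
          nlinarith [sq_nonneg ‖x₀‖]
        have h3 : 0 < lam * (5 * (1 + β)) := by positivity
        nlinarith [mul_le_mul_of_nonneg_left h2 h3.le]
      linarith
    · rw [hM, (hbd x₀ hone).1, (hbd x₀ hone).2, (hbd' x₀ hone).1, (hbd' x₀ hone).2]
      simp
  have hz := hle x hx
  have hz' : M * (2 - ‖x‖ ^ 2) ≤ 0 :=
    mul_nonpos_of_nonpos_of_nonneg hM0 (by linarith [hg x hx])
  have hsp := sq_nonneg ‖ψp x - ψp' x‖
  have hsm := sq_nonneg ‖ψm x - ψm' x‖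
  constructor
  · have : ‖ψp x - ψp' x‖ ^ 2 = 0 := by linarith
    exact sub_eq_zero.1 (norm_eq_zero.1 (pow_eq_zero_iff two_ne_zero |>.1 this))
  · have : ‖ψm x - ψm' x‖ ^ 2 = 0 := by linarith
    exact sub_eq_zero.1 (norm_eq_zero.1 (pow_eq_zero_iff two_ne_zero |>.1 this))
end
end
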